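/- Suppose m = m(n) with m, n → ∞, let p = p(n) := m/C(n,2), and assume liminf_n p(n) > 0. For each n fix three distinct vertices s, a, b of ⃗G(n,m). Then Cov({s↛a}, {b↛s}) = ( (3/(4−2p))·e^{−2p(1−p)/(2−p)²} − 1 + o(1) )·P(s↛a)² = ( 3·e^{−2p(1−p)/(2−p)²} − 4 + 2p + o(1) )·(1 − p/2)^{2n−3}·e^{−2p(1−p)/(2−p)²} as n → ∞. -/

import Mathlib

open Filter Real

/-- Edges of the complete graph on `Fin n`: ordered pairs `(u,v)` with `u < v`. -/
abbrev Edge (n : ℕ) : Type := {e : Fin n × Fin n // e.1 < e.2}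

/-- A configuration of the random edge-orientation model: for each pair `u < v`,
`none` means no edge, `some true` means the directed edge `u → v`, and
`some false` means the directed edge `v → u`. -/
abbrev Config (n : ℕ) : Type := Edge n → Option Bool

/-- The directed edge relation determined by a configuration. -/
def DirEdge {n : ℕ} (f : Config n) (u v : Fin n) : Prop :=
  (∃ h : u < v, f ⟨(u, v), h⟩ = some true) ∨ (∃ h : v < u, f ⟨(v, u), h⟩ = some false)

/-- `Reaches f u v`: the configuration `f` contains a directed path from `u` to `v`
(paths of length `0` are allowed, so `Reaches f u u` always holds). -/
def Reaches {n : ℕ} (f : Config n) (u v : Fin n) : Prop :=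
  Relation.ReflTransGen (DirEdge f) u v

/-- The probability of an event under a weight function on a finite sample space. -/
noncomputable def prWeight {α : Type*} [Fintype α] (w : α → ℝ) (E : Set α) : ℝ :=
  ∑ x, E.indicator w x

/-- The weight of one edge state in `⃗G(n,p)`: no edge has probability `1 - p`
and each of the two orientations has probability `p/2`. -/
noncomputable def edgeWeight (p : ℝ) : Option Bool → ℝ
  | none => 1 - p
  | some _ => p / 2

/-- The probability of an event in the random directed graph `⃗G(n,p)`. -/
noncomputable def PrGnp (n : ℕ) (p : ℝ) (E : Set (Config n)) : ℝ :=
  prWeight (fun f => ∏ e : Edge n, edgeWeight p (f e)) E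

/-- The number of present edges of a configuration. -/
def edgeCount {n : ℕ} (f : Config n) : ℕ :=
  (Finset.univ.filter fun e : Edge n => (f e).isSome).card

/-- The probability of an event in the random directed graph `⃗G(n,m)`:
the underlying graph is uniform among the graphs with exactly `m` edges, and each
present edge is oriented in one of its two directions with probability `1/2`,
independently over edges. -/
noncomputable def PrGnm (n m : ℕ) (E : Set (Config n)) : ℝ :=
  prWeight (fun f => if edgeCount f = m
      then ((Nat.choose (Nat.choose n 2) m : ℝ) * 2 ^ m)⁻¹ else 0) E

section RestrictedCount
open Polynomial

/-- The number of partial orientations with `m` present edges of a graph with `k` edges that have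
one forbidden direction and `j` unconstrained edges. -/
noncomputable def restrictedCount (m k j : ℕ) : ℝ :=
  (((1 + X) ^ k * (1 + 2 * X) ^ j : ℝ[X])).coeff m

lemma coeff_nonneg_mul {P Q : ℝ[X]} (hP : ∀ i, 0 ≤ P.coeff i) (hQ : ∀ i, 0 ≤ Q.coeff i) (i : ℕ) :
    0 ≤ (P * Q).coeff i := by
  rw [coeff_mul]
  exact Finset.sum_nonneg fun x _ => mul_nonneg (hP _) (hQ _)

lemma coeff_nonneg_pow {P : ℝ[X]} (hP : ∀ i, 0 ≤ P.coeff i) (k i : ℕ) :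
    0 ≤ (P ^ k).coeff i := by
  induction k generalizing i with
  | zero => rw [pow_zero, coeff_one]; split_ifs <;> norm_num
  | succ k ih => rw [pow_succ]; exact coeff_nonneg_mul ih hP i

lemma restrictedCount_nonneg (m k j : ℕ) : 0 ≤ restrictedCount m k j := by
  refine coeff_nonneg_mul (coeff_nonneg_pow (fun i => ?_) k) (coeff_nonneg_pow (fun i => ?_) j) m
  · rw [coeff_add, coeff_one, coeff_X]; split_ifs <;> norm_num
  · rw [coeff_add, coeff_one, show (2 : ℝ[X]) = C 2 from rfl, coeff_C_mul, coeff_X]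
    split_ifs <;> norm_num

lemma restrictedCount_sub (m k j : ℕ) :
    restrictedCount m k (j + 1) - restrictedCount m (k + 1) j =
      (X * ((1 + X) ^ k * (1 + 2 * X) ^ j) : ℝ[X]).coeff m := by
  rw [restrictedCount, restrictedCount, ← coeff_sub]
  congr 1; ring

lemma restrictedCount_succ_le (m k j : ℕ) :
    restrictedCount m (k + 1) j ≤ restrictedCount m k (j + 1) := by
  rw [← sub_nonneg, restrictedCount_sub]
  cases m with
  | zero => simp
  | succ m => rw [coeff_X_mul]; exact restrictedCount_nonneg m k j

lemma restrictedCount_le_two_mul_succ (m k j : ℕ) :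
    restrictedCount m k (j + 1) ≤ 2 * restrictedCount m (k + 1) j := by
  have h : 2 * restrictedCount m (k + 1) j - restrictedCount m k (j + 1) =
      restrictedCount m k j := by
    simp only [restrictedCount]
    rw [← coeff_C_mul, ← coeff_sub]
    congr 1
    rw [show (C 2 : ℝ[X]) = 2 from rfl]; ring
  linarith [restrictedCount_nonneg m k j]

lemma coeff_X_mul_derivative (P : ℝ[X]) (m : ℕ) :
    (X * derivative P).coeff m = m * P.coeff m := by
  cases m with
  | zero => simp
  | succ m => rw [coeff_X_mul, coeff_derivative]; push_cast; ring

lemma restrictedCount_recurrence (m k j : ℕ) :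
    m * restrictedCount m (k + 1) (j + 1) =
      (k + 1) * (restrictedCount m k (j + 2) - restrictedCount m (k + 1) (j + 1)) +
      2 * (j + 1) * (restrictedCount m (k + 1) (j + 1) - restrictedCount m (k + 2) j) := by
  rw [restrictedCount_sub, restrictedCount_sub, restrictedCount, ← coeff_X_mul_derivative]
  rw [show ((k : ℝ) + 1) * (X * ((1 + X) ^ k * (1 + 2 * X) ^ (j + 1)) : ℝ[X]).coeff m =
    (C ((k : ℝ) + 1) * (X * ((1 + X) ^ k * (1 + 2 * X) ^ (j + 1)))).coeff m from
    (coeff_C_mul _).symm, show (2 * ((j : ℝ) + 1)) * (X * ((1 + X) ^ (k + 1) * (1 + 2 * X) ^ j) :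
    ℝ[X]).coeff m = (C (2 * ((j : ℝ) + 1)) * (X * ((1 + X) ^ (k + 1) * (1 + 2 * X) ^ j))).coeff m
    from (coeff_C_mul _).symm, ← coeff_add]
  congr 1
  have h2 : derivative (2 * X : ℝ[X]) = 2 := by
    rw [show (2 : ℝ[X]) = C 2 from rfl, derivative_C_mul]; simp
  simp only [derivative_mul, derivative_pow, derivative_add, derivative_one, derivative_X, h2]
  simp only [map_add, map_mul, map_natCast, map_one, Nat.cast_add, Nat.cast_one,
    Nat.add_sub_cancel, show (C 2 : ℝ[X]) = 2 from rfl]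
  ring

lemma restrictedCount_recurrence_zero (m j : ℕ) :
    m * restrictedCount m 0 (j + 1) =
      2 * (j + 1) * (restrictedCount m 0 (j + 1) - restrictedCount m 1 j) := by
  rw [restrictedCount_sub m 0 j, restrictedCount, ← coeff_X_mul_derivative]
  rw [show (2 * ((j : ℝ) + 1)) * (X * ((1 + X) ^ 0 * (1 + 2 * X) ^ j) :
    ℝ[X]).coeff m = (C (2 * ((j : ℝ) + 1)) * (X * ((1 + X) ^ 0 * (1 + 2 * X) ^ j))).coeff m
    from (coeff_C_mul _).symm]
  congr 1
  have h2 : derivative (2 * X : ℝ[X]) = 2 := by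
    rw [show (2 : ℝ[X]) = C 2 from rfl, derivative_C_mul]; simp
  simp only [pow_zero, one_mul, derivative_pow, derivative_add, derivative_one, h2]
  simp only [map_add, map_mul, map_natCast, map_one, Nat.cast_add, Nat.cast_one,
    Nat.add_sub_cancel, show (C 2 : ℝ[X]) = 2 from rfl]
  ring

lemma restrictedCount_zero (m N : ℕ) : restrictedCount m 0 N = N.choose m * 2 ^ m := by
  rw [restrictedCount, pow_zero, one_mul, show (1 + 2 * X : ℝ[X]) = (1 + X).comp (2 * X) by simp,
    ← pow_comp, show (2 : ℝ[X]) = C 2 from rfl, comp_C_mul_X_coeff, add_comm, coeff_X_add_one_pow]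

end RestrictedCount

/-- The probability that none of `k` prescribed arcs on distinct vertex pairs is present, when
the underlying graph has `m` of the `N` possible edges. -/
noncomputable def avoidProb (N m k : ℕ) : ℝ :=
  restrictedCount m k (N - k) / restrictedCount m 0 N

lemma avoidProb_zero {N m : ℕ} (h : m ≤ N) : avoidProb N m 0 = 1 := by
  have : (0 : ℝ) < N.choose m := by exact_mod_cast Nat.choose_pos h
  rw [avoidProb, Nat.sub_zero, restrictedCount_zero]
  exact div_self (by positivity)

lemma avoidProb_nonneg (N m k : ℕ) : 0 ≤ avoidProb N m k :=
  div_nonneg (restrictedCount_nonneg _ _ _) (restrictedCount_nonneg _ _ _)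

lemma avoidProb_succ_le {N m k : ℕ} (hk : k < N) : avoidProb N m (k + 1) ≤ avoidProb N m k := by
  obtain ⟨j, rfl⟩ := Nat.exists_eq_add_of_lt hk
  refine div_le_div_of_nonneg_right ?_ (restrictedCount_nonneg _ _ _)
  rw [show k + j + 1 - k = j + 1 by omega, show k + j + 1 - (k + 1) = j by omega]
  exact restrictedCount_succ_le m k j

lemma avoidProb_le_two_mul_succ {N m k : ℕ} (hk : k < N) :
    avoidProb N m k ≤ 2 * avoidProb N m (k + 1) := by
  obtain ⟨j, rfl⟩ := Nat.exists_eq_add_of_lt hk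
  rw [avoidProb, avoidProb, ← mul_div_assoc]
  refine div_le_div_of_nonneg_right ?_ (restrictedCount_nonneg _ _ _)
  rw [show k + j + 1 - k = j + 1 by omega, show k + j + 1 - (k + 1) = j by omega]
  exact restrictedCount_le_two_mul_succ m k j

lemma avoidProb_pos {N m k : ℕ} (h : m ≤ N) (hk : k ≤ N) : 0 < avoidProb N m k := by
  induction k with
  | zero => rw [avoidProb_zero h]; norm_num
  | succ k ih => linarith [ih (by omega), avoidProb_le_two_mul_succ (m := m) (show k < N by omega)]

lemma avoidProb_recurrence {N m k : ℕ} (hk : k + 2 ≤ N) :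
    m * avoidProb N m (k + 1) = (k + 1) * (avoidProb N m k - avoidProb N m (k + 1)) +
      2 * (N - (k + 1)) * (avoidProb N m (k + 1) - avoidProb N m (k + 2)) := by
  obtain ⟨j, rfl⟩ := Nat.exists_eq_add_of_le hk
  have h := restrictedCount_recurrence m k j
  simp only [avoidProb]
  rw [show k + 2 + j - k = j + 2 by omega, show k + 2 + j - (k + 1) = j + 1 by omega,
    show k + 2 + j - (k + 2) = j by omega]
  push_cast
  rw [← mul_div_assoc, h]
  ring

lemma avoidProb_recurrence_zero {N m : ℕ} (hN : 1 ≤ N) :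
    m * avoidProb N m 0 = 2 * N * (avoidProb N m 0 - avoidProb N m 1) := by
  obtain ⟨j, rfl⟩ := Nat.exists_eq_add_of_le' hN
  have h := restrictedCount_recurrence_zero m j
  simp only [avoidProb]
  rw [Nat.sub_zero, Nat.add_sub_cancel]
  push_cast
  rw [← mul_div_assoc, h]
  ring

lemma abs_sub_le_of_average {p r q κ : ℝ} (hp0 : 0 ≤ p) (hp1 : p ≤ 1) (hr0 : 0 ≤ r) (hr1 : r ≤ 1)
    (hκ0 : 0 ≤ κ) (hκ1 : κ ≤ 1 / 2) (h : κ * r + (1 - κ) * q = p) : |q - p| ≤ 2 * κ := by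
  have h1 : (1 - κ) * (q - p) = κ * (p - r) := by linear_combination h
  rw [abs_le]
  constructor <;> nlinarith [mul_nonneg hκ0 (sub_nonneg.2 hp1), mul_nonneg hκ0 hp0,
    mul_nonneg hκ0 (sub_nonneg.2 hr1), mul_nonneg hκ0 hr0]

lemma abs_div_two_sub_le {p q : ℝ} (hp1 : p ≤ 1) (hq1 : q ≤ 1) :
    |q / (2 - q) - p / (2 - p)| ≤ 2 * |q - p| := by
  have h1 : 0 < 2 - q := by linarith
  have h2 : 0 < 2 - p := by linarith
  have h : q / (2 - q) - p / (2 - p) = 2 * (q - p) / ((2 - q) * (2 - p)) := by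
    field_simp; ring
  rw [h, abs_div, abs_mul, abs_two, abs_of_pos (mul_pos h1 h2)]
  exact div_le_self (by positivity) (by nlinarith)

lemma abs_sub_sub_le_of_average {p q₀ q κ : ℝ} (hp0 : 0 ≤ p) (hp1 : p ≤ 1)
    (hq1 : q₀ ≤ 1) (hκ0 : 0 ≤ κ) (hκ1 : κ ≤ 1 / 2) (hq : |q₀ - p| ≤ 2 * κ)
    (h : κ * (q₀ / (2 - q₀)) + (1 - κ) * q = p) :
    |q - p - κ * (p * (1 - p) / (2 - p))| ≤ 10 * κ ^ 2 := by
  have h2 : 0 < 2 - p := by linarith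
  set β := p * (1 - p) / (2 - p) with hβ
  have hβ' : β = p - p / (2 - p) := by rw [hβ]; field_simp; ring
  have hβ0 : 0 ≤ β := div_nonneg (mul_nonneg hp0 (by linarith)) h2.le
  have hβ1 : β ≤ 1 := by rw [hβ, div_le_one h2]; nlinarith
  have hr := (abs_div_two_sub_le hp1 hq1).trans (mul_le_mul_of_nonneg_left hq zero_le_two)
  set r := q₀ / (2 - q₀)
  have h1 : (1 - κ) * (q - p - κ * β) = κ * (p / (2 - p) - r) + κ ^ 2 * β := by
    rw [hβ']; linear_combination h
  rw [abs_le] at hr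
  have hb := mul_nonneg (sq_nonneg κ) hβ0
  have hb' := mul_nonneg (sq_nonneg κ) (sub_nonneg.2 hβ1)
  have hc := mul_nonneg hκ0 (sub_nonneg.2 hr.1)
  have hc' := mul_nonneg hκ0 (sub_nonneg.2 hr.2)
  have hl : (1 - κ) * (q - p - κ * β) ≤ 5 * κ ^ 2 := by nlinarith
  have hu : -(5 * κ ^ 2) ≤ (1 - κ) * (q - p - κ * β) := by nlinarith
  rw [abs_le]
  constructor <;> nlinarith [sq_nonneg κ, mul_nonneg (sq_nonneg κ) (sub_nonneg.2 hκ1)]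

lemma abs_mul_exp_sub_one_le {α κ u e η : ℝ} (hα0 : 0 ≤ α) (hα1 : α ≤ 1) (hκ0 : 0 ≤ κ)
    (hu : 0 ≤ u) (hη : κ + u / 2 ≤ η) (hη1 : η ≤ 1 / 2) (he : |e| ≤ 10 * κ ^ 2) :
    |(1 - α * κ + e) * exp (α * (κ + u / 2)) - 1| ≤ u + 30 * η ^ 2 := by
  set z := α * (κ + u / 2) with hz
  have hs : 0 ≤ κ + u / 2 := by positivity
  have hz0 : 0 ≤ z := mul_nonneg hα0 hs
  have hzη : z ≤ η := (mul_le_of_le_one_left hs hα1).trans hη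
  have hκη : κ ≤ η := by linarith
  have hη0 : 0 ≤ η := hκ0.trans hκη
  have hexp := Real.abs_exp_sub_one_sub_id_le (x := z) (by rw [abs_of_nonneg hz0]; linarith)
  have hzz : z ^ 2 ≤ η ^ 2 := by gcongr
  have hκκ : κ ^ 2 ≤ η ^ 2 := by gcongr
  have hακ : α * κ ≤ η := (mul_le_of_le_one_left hκ0 hα1).trans hκη
  have hακ0 : 0 ≤ α * κ := mul_nonneg hα0 hκ0
  have hexp2 : exp z ≤ 2 := by
    have := (abs_le.1 hexp).2
    nlinarith
  have hid : (1 - α * κ + e) * exp z - 1 =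
      (1 - α * κ) * (exp z - 1 - z) + (α * u / 2 - α * κ * z) + e * exp z := by
    rw [hz]; ring
  have h1 : |(1 - α * κ) * (exp z - 1 - z)| ≤ η ^ 2 := by
    rw [abs_mul, abs_of_nonneg (by linarith)]
    exact (mul_le_of_le_one_left (abs_nonneg _) (by linarith)).trans (hexp.trans hzz)
  have h2 : |α * u / 2 - α * κ * z| ≤ u + η ^ 2 := by
    have h3 : α * κ * z ≤ η * η := by gcongr
    have h4 : 0 ≤ α * κ * z := by positivity
    have h5 : α * u ≤ u := mul_le_of_le_one_left hu hα1
    have h6 : 0 ≤ α * u := by positivity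
    rw [abs_le]; constructor <;> nlinarith
  have h3 : |e * exp z| ≤ 20 * η ^ 2 := by
    rw [abs_mul, abs_of_pos (exp_pos z)]
    calc |e| * exp z ≤ (10 * κ ^ 2) * 2 := by gcongr
      _ ≤ _ := by linarith
  rw [hid]
  refine (abs_add_three _ _ _).trans ?_
  nlinarith [sq_nonneg η]

/-- The conditional probability that a further vertex pair is an edge, given that `k` prescribed
arcs are absent. -/
noncomputable def condDensity (N m k : ℕ) : ℝ :=
  2 * (avoidProb N m k - avoidProb N m (k + 1)) / avoidProb N m k

section Recursion
variable {N m k : ℕ}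

lemma condDensity_nonneg (hk : k < N) : 0 ≤ condDensity N m k :=
  div_nonneg (by linarith [avoidProb_succ_le (m := m) hk]) (avoidProb_nonneg _ _ _)

lemma condDensity_le_one (hm : m ≤ N) (hk : k < N) : condDensity N m k ≤ 1 := by
  rw [condDensity, div_le_one (avoidProb_pos hm hk.le)]
  linarith [avoidProb_le_two_mul_succ (m := m) hk]

lemma avoidProb_succ (hm : m ≤ N) (hk : k < N) :
    avoidProb N m (k + 1) = avoidProb N m k * (1 - condDensity N m k / 2) := by
  have := avoidProb_pos hm hk.le
  rw [condDensity]; field_simp; ring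

lemma condDensity_zero (hm : m ≤ N) (hN : 1 ≤ N) : condDensity N m 0 = m / N := by
  have h := avoidProb_recurrence_zero (m := m) hN
  have hN' : (0 : ℝ) < N := by exact_mod_cast hN
  rw [condDensity]
  rw [avoidProb_zero hm] at *
  field_simp
  linarith

lemma condDensity_average (hm : m ≤ N) (hk : k + 1 < N) :
    ((k + 1 : ℕ) / N : ℝ) * (condDensity N m k / (2 - condDensity N m k)) +
      (1 - ((k + 1 : ℕ) / N : ℝ)) * condDensity N m (k + 1) = m / N := by
  have hN' : (0 : ℝ) < N := by exact_mod_cast (by omega : 0 < N)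
  have h := avoidProb_recurrence (m := m) (show k + 2 ≤ N by omega)
  have h0 := avoidProb_pos hm (show k ≤ N by omega)
  have h1 := avoidProb_pos hm (show k + 1 ≤ N by omega)
  have hr : condDensity N m k / (2 - condDensity N m k) =
      (avoidProb N m k - avoidProb N m (k + 1)) / avoidProb N m (k + 1) := by
    have : 2 - condDensity N m k = 2 * avoidProb N m (k + 1) / avoidProb N m k := by
      rw [condDensity]; field_simp; ring
    rw [this, condDensity]; field_simp
  rw [hr, condDensity]
  push_cast
  field_simp
  linarith

lemma abs_condDensity_sub_le (hm : m ≤ N) (hN : 1 ≤ N) (hk : 2 * k ≤ N) :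
    |condDensity N m k - m / N| ≤ 2 * (k / N) := by
  have hN' : (0 : ℝ) < N := by exact_mod_cast hN
  cases k with
  | zero => rw [condDensity_zero hm hN]; simp
  | succ k =>
    have h0 := condDensity_nonneg (m := m) (show k < N by omega)
    have h1 := condDensity_le_one hm (show k < N by omega)
    refine abs_sub_le_of_average (by positivity) ?_ ?_ ?_ (by positivity) ?_
      (condDensity_average hm (by omega))
    · rw [div_le_one hN']; exact_mod_cast hm
    · exact div_nonneg h0 (by linarith)
    · rw [div_le_one (by linarith)]; linarith
    · rw [div_le_div_iff₀ hN' two_pos]; exact_mod_cast (by omega : (k + 1) * 2 ≤ 1 * N)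

lemma abs_condDensity_sub_sub_le (hm : m ≤ N) (hN : 1 ≤ N) (hk : 2 * k ≤ N) :
    |condDensity N m k - m / N - k / N * (m / N * (1 - m / N) / (2 - m / N))| ≤
      10 * (k / N : ℝ) ^ 2 := by
  have hN' : (0 : ℝ) < N := by exact_mod_cast hN
  cases k with
  | zero => rw [condDensity_zero hm hN]; simp
  | succ k =>
    have h0 := condDensity_nonneg (m := m) (show k < N by omega)
    have h1 := condDensity_le_one hm (show k < N by omega)
    refine abs_sub_sub_le_of_average (by positivity) ?_ h1 (by positivity) ?_ ?_
      (condDensity_average hm (by omega))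
    · rw [div_le_one hN']; exact_mod_cast hm
    · rw [div_le_div_iff₀ hN' two_pos]; exact_mod_cast (by omega : (k + 1) * 2 ≤ 1 * N)
    · refine (abs_condDensity_sub_le hm hN (by omega)).trans ?_
      gcongr
      omega

lemma variance_ratio_bounds {p : ℝ} (hp0 : 0 ≤ p) (hp1 : p ≤ 1) :
    0 ≤ p * (1 - p) / (2 - p) ^ 2 ∧ p * (1 - p) / (2 - p) ^ 2 ≤ 1 := by
  refine ⟨div_nonneg (mul_nonneg hp0 (by linarith)) (sq_nonneg _), ?_⟩
  rw [div_le_one (by nlinarith)]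
  nlinarith

/-- Uniform approximation of the avoidance probability for `K` much smaller than `N ^ (2 / 3)`. -/
lemma abs_avoidProb_div_sub_one_le {K : ℕ} {p : ℝ} (hm : m ≤ N) (hN : 1 ≤ N) (hK : 2 * K ≤ N)
    (hp : p = m / N) (hk : k ≤ K) :
    |avoidProb N m k / ((1 - p / 2) ^ k * exp (-(p * (1 - p) / (2 - p) ^ 2 * (k ^ 2 / (2 * N)))))
        - 1| ≤ exp (k * (1 / N + 30 * (K / N : ℝ) ^ 2)) - 1 := by
  have hN' : (0 : ℝ) < N := by exact_mod_cast hN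
  have hp0 : 0 ≤ p := by rw [hp]; positivity
  have hp1 : p ≤ 1 := by rw [hp, div_le_one hN']; exact_mod_cast hm
  obtain ⟨hα0, hα1⟩ := variance_ratio_bounds hp0 hp1
  set α := p * (1 - p) / (2 - p) ^ 2 with hα
  have hx : 0 < 1 - p / 2 := by linarith
  induction k with
  | zero => simp [avoidProb_zero hm]
  | succ k ih =>
    specialize ih (by omega)
    set d : ℝ := 1 / N + 30 * (K / N : ℝ) ^ 2 with hd
    have hd0 : 0 ≤ d := by positivity
    set g := avoidProb N m k / ((1 - p / 2) ^ k * exp (-(α * (k ^ 2 / (2 * N))))) with hg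
    set e := -(condDensity N m k - p - k / N * (p * (1 - p) / (2 - p))) / (2 - p) with he
    set t := (1 - α * (k / N) + e) * exp (α * (k / N + 1 / N / 2)) with ht
    have hstep : avoidProb N m (k + 1) / ((1 - p / 2) ^ (k + 1) *
        exp (-(α * (((k + 1 : ℕ) : ℝ) ^ 2 / (2 * N))))) = g * t := by
      have h1 : exp (-(α * (((k + 1 : ℕ) : ℝ) ^ 2 / (2 * N)))) =
          exp (-(α * (k ^ 2 / (2 * N)))) / exp (α * (k / N + 1 / N / 2)) := by
        rw [← exp_sub]; congr 1; push_cast; field_simp; ring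
      have h2 : 1 - condDensity N m k / 2 = (1 - α * (k / N) + e) * (1 - p / 2) := by
        have : 2 - p ≠ 0 := by linarith
        rw [he, hα]; field_simp; ring
      rw [avoidProb_succ hm (by omega), h1, h2, hg, ht]
      have hE₁ := (exp_pos (-(α * (k ^ 2 / (2 * N))))).ne'
      have hE₂ := (exp_pos (α * (k / N + 1 / N / 2))).ne'
      have hx' := hx.ne'
      generalize 1 - α * (k / N) + e = c
      generalize 1 - p / 2 = x at hx' ⊢
      field_simp
      ring
    have hkN : (k / N + 1 / N / 2 : ℝ) ≤ K / N := by
      have : (k : ℝ) + 1 ≤ K := by exact_mod_cast hk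
      rw [div_div, ← sub_nonneg]
      have : (K / N - (k / N + 1 / (N * 2)) : ℝ) = (K - k - 1 / 2) / N := by field_simp; ring
      rw [this]
      exact div_nonneg (by linarith) hN'.le
    have ht1 : |t - 1| ≤ d := by
      refine abs_mul_exp_sub_one_le hα0 hα1 (by positivity) (by positivity) hkN ?_ ?_
      · rw [div_le_div_iff₀ hN' two_pos]; exact_mod_cast (by omega : K * 2 ≤ 1 * N)
      · rw [he, abs_div, abs_neg, abs_of_pos (by linarith : 0 < 2 - p)]
        refine (div_le_self (abs_nonneg _) (by linarith)).trans ?_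
        rw [hp]
        exact abs_condDensity_sub_sub_le hm hN (by omega)
    rw [hstep]
    have hge : 0 ≤ exp (k * d) - 1 := (abs_nonneg _).trans ih
    calc |g * t - 1| = |(g - 1) * (t - 1) + (g - 1) + (t - 1)| := by congr 1; ring
      _ ≤ |(g - 1) * (t - 1)| + |g - 1| + |t - 1| := abs_add_three _ _ _
      _ ≤ (exp (k * d) - 1) * d + (exp (k * d) - 1) + d := by
        rw [abs_mul]; gcongr
      _ = exp (k * d) * (d + 1) - 1 := by ring
      _ ≤ exp (k * d) * exp d - 1 := by gcongr; exact add_one_le_exp d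
      _ = _ := by rw [← exp_add]; push_cast; ring_nf

end Recursion

section PrWeight
variable {α : Type*} [Fintype α] {w : α → ℝ}

lemma prWeight_nonneg (hw : ∀ x, 0 ≤ w x) (E : Set α) : 0 ≤ prWeight w E :=
  Finset.sum_nonneg fun _ _ => Set.indicator_nonneg (fun x _ => hw x) _

lemma prWeight_mono (hw : ∀ x, 0 ≤ w x) {E F : Set α} (h : E ⊆ F) :
    prWeight w E ≤ prWeight w F :=
  Finset.sum_le_sum fun x _ => Set.indicator_le_indicator_of_subset h (fun x => hw x) x

lemma prWeight_union_le (hw : ∀ x, 0 ≤ w x) (E F : Set α) :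
    prWeight w (E ∪ F) ≤ prWeight w E + prWeight w F := by
  classical
  rw [prWeight, prWeight, prWeight, ← Finset.sum_add_distrib]
  refine Finset.sum_le_sum fun x _ => ?_
  have := hw x
  by_cases hE : x ∈ E <;> by_cases hF : x ∈ F <;> simp [hE, hF, this]

lemma prWeight_biUnion_le (hw : ∀ x, 0 ≤ w x) {ι : Type*} (I : Finset ι) (E : ι → Set α) :
    prWeight w (⋃ i ∈ I, E i) ≤ ∑ i ∈ I, prWeight w (E i) := by
  classical
  induction I using Finset.induction_on with
  | empty => simp [prWeight]
  | insert i I hi ih =>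
    rw [Finset.set_biUnion_insert, Finset.sum_insert hi]
    exact (prWeight_union_le hw _ _).trans (by gcongr)

end PrWeight

section Arcs
variable {n : ℕ}

/-- The event that none of the arcs in `A` is present. -/
def NoArc (A : Finset (Fin n × Fin n)) : Set (Config n) :=
  {f | ∀ a ∈ A, ¬ DirEdge f a.1 a.2}

/-- The edge states compatible with the absence of the arcs in `A`. -/
def allowedStates (A : Finset (Fin n × Fin n)) (e : Edge n) : Finset (Option Bool) :=
  Finset.univ.filter fun o => (o = some true → e.1 ∉ A) ∧ (o = some false → e.1.swap ∉ A)

lemma sum_allowedStates {M : Type*} [AddCommMonoid M] (A : Finset (Fin n × Fin n)) (e : Edge n)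
    (g : Option Bool → M) :
    ∑ o ∈ allowedStates A e, g o = g none + ((if e.1 ∈ A then 0 else g (some true)) +
      (if e.1.swap ∈ A then 0 else g (some false))) := by
  rw [allowedStates, Finset.sum_filter, Fintype.sum_option, Fintype.sum_bool]
  simp [ite_not]

lemma mem_noArc_iff {A : Finset (Fin n × Fin n)} {f : Config n} :
    f ∈ NoArc A ↔ f ∈ Fintype.piFinset (allowedStates A) := by
  simp only [NoArc, Set.mem_ofPred_eq, Fintype.mem_piFinset, allowedStates, Finset.mem_filter,
    Finset.mem_univ, true_and, DirEdge]
  constructor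
  · rintro h ⟨⟨u, v⟩, huv⟩
    exact ⟨fun ho hA => h _ hA (Or.inl ⟨huv, ho⟩), fun ho hA => h _ hA (Or.inr ⟨huv, ho⟩)⟩
  · rintro h ⟨u, v⟩ hA (⟨huv, ho⟩ | ⟨huv, ho⟩)
    · exact (h _).1 ho hA
    · exact (h _).2 ho hA

lemma sum_edge_indicator (A : Finset (Fin n × Fin n)) (hA : ∀ a ∈ A, a.1 ≠ a.2) :
    ∑ e : Edge n, ((if e.1 ∈ A then 1 else 0) + (if e.1.swap ∈ A then 1 else 0)) = A.card := by
  have h1 : ∑ e : Edge n, (if e.1 ∈ A then 1 else 0) = (A.filter fun a => a.1 < a.2).card := by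
    rw [← Finset.sum_subtype (Finset.univ.filter fun a : Fin n × Fin n => a.1 < a.2) (by simp)
      (fun a => if a ∈ A then 1 else 0), Finset.card_filter, ← Finset.sum_filter,
      ← Finset.card_eq_sum_ones, ← Finset.card_filter]
    congr 1; ext a; simp [and_comm]
  have h2 : ∑ e : Edge n, (if e.1.swap ∈ A then 1 else 0) =
      (A.filter fun a => ¬ a.1 < a.2).card := by
    rw [← Finset.sum_subtype (Finset.univ.filter fun a : Fin n × Fin n => a.1 < a.2) (by simp)
      (fun a => if a.swap ∈ A then 1 else 0), ← Finset.sum_filter,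
      ← Finset.card_eq_sum_ones]
    refine Finset.card_bij (fun a _ => a.swap) ?_ (fun a _ b _ h => Prod.swap_injective h) ?_
    · intro a ha
      simp only [Finset.mem_filter, Finset.mem_univ, true_and] at ha ⊢
      exact ⟨ha.2, not_lt.2 ha.1.le⟩
    · intro a ha
      simp only [Finset.mem_filter, Finset.mem_univ, true_and, not_lt] at ha ⊢
      exact ⟨a.swap, ⟨lt_of_le_of_ne ha.2 (hA a ha.1).symm, by simpa using ha.1⟩, by simp⟩
  rw [Finset.sum_add_distrib, h1, h2, Finset.card_filter_add_card_filter_not]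

lemma card_edge (n : ℕ) : Fintype.card (Edge n) = n.choose 2 := by
  have h := sum_edge_indicator (Finset.univ.offDiag : Finset (Fin n × Fin n)) (by simp)
  have h' : ∀ e : Edge n, ((if e.1 ∈ (Finset.univ.offDiag : Finset (Fin n × Fin n)) then 1 else 0) +
      (if e.1.swap ∈ (Finset.univ.offDiag : Finset (Fin n × Fin n)) then 1 else 0)) = 2 := by
    intro e
    simp [e.2.ne, e.2.ne']
  rw [Finset.sum_congr rfl fun e _ => h' e, Finset.offDiag_card] at h
  simp only [Finset.sum_const, Finset.card_univ, Fintype.card_fin, smul_eq_mul] at h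
  rw [Nat.choose_two_right, Nat.mul_sub, mul_one]
  omega

lemma prWeight_noArc (A : Finset (Fin n × Fin n)) (w : Config n → ℝ) :
    prWeight w (NoArc A) = ∑ f ∈ Fintype.piFinset (allowedStates A), w f := by
  classical
  rw [prWeight, ← Finset.sum_filter_add_sum_filter_not Finset.univ (· ∈ NoArc A)]
  rw [Finset.sum_eq_zero (s := Finset.univ.filter fun f => f ∉ NoArc A), add_zero]
  · refine Finset.sum_congr ?_ fun f hf => ?_
    · ext f; simp [mem_noArc_iff]
    · rw [← mem_noArc_iff] at hf
      exact Set.indicator_of_mem hf w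
  · intro f hf
    exact Set.indicator_of_notMem (Finset.mem_filter.1 hf).2 w

lemma PrGnp_noArc (A : Finset (Fin n × Fin n)) (p : ℝ) :
    PrGnp n p (NoArc A) = ∏ e : Edge n, (1 - p + ((if e.1 ∈ A then 0 else p / 2) +
      (if e.1.swap ∈ A then 0 else p / 2))) := by
  rw [PrGnp, prWeight_noArc, ← Finset.prod_univ_sum (allowedStates A) fun _ o => edgeWeight p o]
  exact Finset.prod_congr rfl fun e _ => sum_allowedStates A e _

/-- Upper bound for the probability that no arc of `A` is present in the binomial model. The
hypothesis `h₁` is only needed for arcs whose reversal is not forbidden. -/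
lemma PrGnp_noArc_le {A : Finset (Fin n × Fin n)} (hA : ∀ a ∈ A, a.1 ≠ a.2) {p y : ℝ}
    (hp1 : p ≤ 1) (h₁ : (∀ a ∈ A, a.swap ∈ A) ∨ 1 - p / 2 ≤ y)
    (h₂ : 1 - p ≤ y ^ 2) : PrGnp n p (NoArc A) ≤ y ^ A.card := by
  rw [PrGnp_noArc, ← sum_edge_indicator A hA, ← Finset.prod_pow_eq_pow_sum]
  refine Finset.prod_le_prod (fun e _ => ?_) (fun e _ => ?_)
  · split_ifs <;> linarith
  · by_cases h : e.1 ∈ A <;> by_cases h' : e.1.swap ∈ A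
    · simpa [h, h'] using h₂
    · rcases h₁ with h₁ | h₁
      · exact absurd (h₁ _ h) h'
      · simp only [h, h', if_true, if_false]; norm_num; linarith
    · rcases h₁ with h₁ | h₁
      · exact absurd (by simpa using h₁ _ h') h
      · simp only [h, h', if_true, if_false]; norm_num; linarith
    · simp [h, h']

open Polynomial in
lemma PrGnm_noArc {A : Finset (Fin n × Fin n)} (hA : ∀ a ∈ A, a.1 ≠ a.2)
    (hA' : ∀ a ∈ A, a.swap ∉ A) (m : ℕ) :
    PrGnm n m (NoArc A) = avoidProb (n.choose 2) m A.card := by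
  have hcard : (Finset.univ.filter fun e : Edge n => e.1 ∈ A ∨ e.1.swap ∈ A).card = A.card := by
    rw [← sum_edge_indicator A hA, Finset.card_filter]
    refine Finset.sum_congr rfl fun e _ => ?_
    by_cases h : e.1 ∈ A
    · simp [h, hA' _ h]
    · simp [h]
  have hcard' : (Finset.univ.filter fun e : Edge n => ¬ (e.1 ∈ A ∨ e.1.swap ∈ A)).card =
      n.choose 2 - A.card := by
    have := Finset.card_filter_add_card_filter_not (s := (Finset.univ : Finset (Edge n)))
      (fun e => e.1 ∈ A ∨ e.1.swap ∈ A)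
    rw [Finset.card_univ, card_edge] at this
    omega
  have hpoly : ∑ f ∈ Fintype.piFinset (allowedStates A), (X : ℝ[X]) ^ edgeCount f =
      (1 + X) ^ A.card * (1 + 2 * X) ^ (n.choose 2 - A.card) := by
    have h := Finset.prod_univ_sum (allowedStates A)
      fun (_ : Edge n) o => (X : ℝ[X]) ^ (if o.isSome then 1 else 0)
    simp only [Finset.prod_pow_eq_pow_sum, ← Finset.card_filter] at h
    simp only [edgeCount]
    rw [← h, ← hcard', ← hcard, ← Finset.prod_const, ← Finset.prod_const,
      ← Finset.prod_filter_mul_prod_filter_not Finset.univ fun e : Edge n =>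
        e.1 ∈ A ∨ e.1.swap ∈ A]
    congr 1
    · refine Finset.prod_congr rfl fun e he => ?_
      rw [sum_allowedStates]
      rcases (Finset.mem_filter.1 he).2 with h | h
      · simp [h, hA' _ h]
      · have h' : e.1 ∉ A := by simpa using hA' _ h
        simp [h, h']
    · refine Finset.prod_congr rfl fun e he => ?_
      have he' := (Finset.mem_filter.1 he).2
      push Not at he'
      rw [sum_allowedStates]
      simp [he'.1, he'.2, two_mul]
  have hc := congrArg (fun P : ℝ[X] => P.coeff m) hpoly
  simp only [finsetSum_coeff, coeff_X_pow] at hc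
  rw [PrGnm, prWeight_noArc, avoidProb, restrictedCount_zero, restrictedCount, ← hc,
    Finset.sum_div]
  refine Finset.sum_congr rfl fun f _ => ?_
  by_cases h : edgeCount f = m
  · simp [h]
  · simp [h, Ne.symm h]

end Arcs

/-- The binomial distribution with integral mean `m` has its mode at `m`. -/
lemma binomial_le_mode {N m : ℕ} {p : ℝ} (hm : m ≤ N) (hp0 : 0 ≤ p) (hp1 : p ≤ 1)
    (hp : N * p = m) {j : ℕ} (hj : j ≤ N) :
    N.choose j * p ^ j * (1 - p) ^ (N - j) ≤ N.choose m * p ^ m * (1 - p) ^ (N - m) := by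
  set T : ℕ → ℝ := fun j => N.choose j * p ^ j * (1 - p) ^ (N - j) with hT
  have hT0 : ∀ j, 0 ≤ T j := fun j => by
    have : 0 ≤ 1 - p := by linarith
    positivity
  have hstep : ∀ j < N, T (j + 1) * ((j + 1) * (1 - p)) = T j * ((N - j) * p) := by
    intro j hj
    obtain ⟨i, rfl⟩ := Nat.exists_eq_add_of_lt hj
    have h := Nat.choose_succ_right_eq (j + i + 1) j
    rw [show j + i + 1 - j = i + 1 by omega] at h
    have h' : ((j + i + 1).choose (j + 1) : ℝ) * (j + 1) = (j + i + 1).choose j * (i + 1) := by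
      exact_mod_cast h
    simp only [hT]
    rw [show j + i + 1 - (j + 1) = i by omega, show j + i + 1 - j = i + 1 by omega]
    push_cast
    linear_combination p ^ (j + 1) * (1 - p) ^ (i + 1) * h'
  have hup : ∀ d, ∀ j, j + d = m → T j ≤ T m := by
    intro d
    induction d with
    | zero => rintro j rfl; exact le_rfl
    | succ d ih =>
      intro j hjd
      refine le_trans ?_ (ih (j + 1) (by omega))
      have hjm : (j : ℝ) + 1 ≤ m := by exact_mod_cast (by omega : j + 1 ≤ m)
      rcases hp1.eq_or_lt with h1 | h1
      · have : T j = 0 := by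
          simp only [hT, h1, sub_self]
          rw [zero_pow (by omega), mul_zero]
        rw [this]; exact hT0 _
      · refine le_of_mul_le_mul_right ?_ (show 0 < ((j : ℝ) + 1) * (1 - p) by
          have : 0 < 1 - p := by linarith
          positivity)
        rw [hstep j (by omega)]
        exact mul_le_mul_of_nonneg_left (by linarith) (hT0 _)
  have hdown : ∀ d, m + d ≤ N → T (m + d) ≤ T m := by
    intro d
    induction d with
    | zero => intro _; exact le_rfl
    | succ d ih =>
      intro hd
      refine le_trans ?_ (ih (by omega))
      have h1 : p < 1 := by
        by_contra h
        have : p = 1 := le_antisymm hp1 (not_lt.1 h)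
        rw [this, mul_one] at hp
        have : N = m := by exact_mod_cast hp
        omega
      have h1' : 0 < 1 - p := by linarith
      refine le_of_mul_le_mul_right ?_ (show 0 < (((m + d : ℕ) : ℝ) + 1) * (1 - p) by positivity)
      rw [← add_assoc, hstep (m + d) (by omega)]
      refine mul_le_mul_of_nonneg_left ?_ (hT0 _)
      push_cast
      have : (0 : ℝ) ≤ d := by positivity
      linarith
  rcases le_total j m with h | h
  · exact hup (m - j) j (by omega)
  · obtain ⟨d, rfl⟩ := Nat.exists_eq_add_of_le h
    exact hdown d hj

lemma one_le_mul_binomial_mode {N m : ℕ} {p : ℝ} (hm : m ≤ N) (hp0 : 0 ≤ p) (hp1 : p ≤ 1)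
    (hp : N * p = m) : 1 ≤ (N + 1) * (N.choose m * p ^ m * (1 - p) ^ (N - m)) := by
  have h : (p + (1 - p)) ^ N = _ := add_pow p (1 - p) N
  rw [add_sub_cancel, one_pow] at h
  calc (1 : ℝ) = ∑ j ∈ Finset.range (N + 1), p ^ j * (1 - p) ^ (N - j) * N.choose j := h
    _ ≤ ∑ _j ∈ Finset.range (N + 1), (N.choose m * p ^ m * (1 - p) ^ (N - m)) := by
      refine Finset.sum_le_sum fun j hj => ?_
      refine le_of_eq_of_le (by ring) (binomial_le_mode hm hp0 hp1 hp
        (Nat.lt_succ_iff.1 (Finset.mem_range.1 hj)))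
    _ = _ := by simp

lemma prod_edgeWeight {n : ℕ} (p : ℝ) (f : Config n) :
    ∏ e : Edge n, edgeWeight p (f e) =
      (p / 2) ^ edgeCount f * (1 - p) ^ (n.choose 2 - edgeCount f) := by
  have h : ∀ e, edgeWeight p (f e) = if (f e).isSome then p / 2 else 1 - p := by
    intro e
    cases f e <;> rfl
  have hcard := Finset.card_filter_add_card_filter_not (s := (Finset.univ : Finset (Edge n)))
    (fun e => (f e).isSome)
  rw [Finset.card_univ, card_edge] at hcard
  rw [Finset.prod_congr rfl fun e _ => h e, Finset.prod_ite, Finset.prod_const, Finset.prod_const,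
    edgeCount]
  congr 2
  omega

lemma edgeWeight_nonneg {p : ℝ} (hp0 : 0 ≤ p) (hp1 : p ≤ 1) (o : Option Bool) :
    0 ≤ edgeWeight p o := by
  cases o
  · exact sub_nonneg.2 hp1
  · exact div_nonneg hp0 zero_le_two

lemma PrGnm_le_PrGnp {n m : ℕ} {p : ℝ} (hm : m ≤ n.choose 2) (hp0 : 0 ≤ p) (hp1 : p ≤ 1)
    (hp : n.choose 2 * p = m) (E : Set (Config n)) :
    PrGnm n m E ≤ (n.choose 2 + 1) * PrGnp n p E := by
  rw [PrGnm, PrGnp, prWeight, prWeight, Finset.mul_sum]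
  refine Finset.sum_le_sum fun f _ => ?_
  have hnn : 0 ≤ ∏ e : Edge n, edgeWeight p (f e) :=
    Finset.prod_nonneg fun e _ => edgeWeight_nonneg hp0 hp1 _
  by_cases hf : f ∈ E
  · rw [Set.indicator_of_mem hf, Set.indicator_of_mem hf]
    split_ifs with h
    · rw [prod_edgeWeight, h]
      have h1 := one_le_mul_binomial_mode hm hp0 hp1 hp
      have hc : (0 : ℝ) < (n.choose 2).choose m := by exact_mod_cast Nat.choose_pos hm
      rw [inv_le_iff_one_le_mul₀ (by positivity)]
      refine h1.trans_eq ?_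
      rw [div_pow]
      field_simp
    · positivity
  · rw [Set.indicator_of_notMem hf, Set.indicator_of_notMem hf, mul_zero]

section Cuts
variable {n : ℕ}

lemma not_reaches_iff {f : Config n} {u v : Fin n} :
    ¬ Reaches f u v ↔ ∃ S : Finset (Fin n), u ∈ S ∧ v ∉ S ∧ f ∈ NoArc (S ×ˢ Sᶜ) := by
  classical
  constructor
  · intro h
    refine ⟨Finset.univ.filter fun w => Reaches f u w, ?_, by simpa using h, ?_⟩
    · exact Finset.mem_filter.2 ⟨Finset.mem_univ _, Relation.ReflTransGen.refl⟩
    · rintro ⟨x, y⟩ hxy hd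
      simp only [Finset.mem_product, Finset.mem_compl, Finset.mem_filter, Finset.mem_univ,
        true_and] at hxy
      exact hxy.2 (hxy.1.tail hd)
  · rintro ⟨S, hu, hv, hS⟩ h
    refine hv ?_
    clear hv
    induction h with
    | refl => exact hu
    | tail _ hd ih =>
      by_contra hc
      exact hS (_, _) (Finset.mem_product.2 ⟨ih, Finset.mem_compl.2 hc⟩) hd

/-- The event that there is a vertex set of size at least `t`, with complement of size at least
`t`, that no arc leaves. -/
def MidCut (n t : ℕ) : Set (Config n) :=
  ⋃ S ∈ Finset.univ.filter (fun S : Finset (Fin n) => t ≤ S.card ∧ S.card + t ≤ n),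
    NoArc (S ×ˢ Sᶜ)

lemma choose_mul_pow_le {t i : ℕ} {x : ℝ} (hx0 : 0 ≤ x) (hx1 : x ≤ 1) (hti : t ≤ i)
    (hi : 2 * i ≤ n) (hn : n * x ^ ((n - 2 * t) / 2) ≤ 1) :
    n.choose i * x ^ (i * (n - i)) ≤ n ^ t * x ^ (t * (n - t)) := by
  obtain ⟨d, rfl⟩ := Nat.exists_eq_add_of_le hti
  have hexp : (t + d) * (n - (t + d)) = t * (n - t) + (n - t - (t + d)) * d := by
    obtain ⟨r, rfl⟩ := Nat.exists_eq_add_of_le hi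
    rw [show 2 * (t + d) + r - (t + d) = t + d + r by omega,
      show 2 * (t + d) + r - t = t + 2 * d + r by omega,
      show t + 2 * d + r - (t + d) = d + r by omega]
    ring
  have hc : (n.choose (t + d) : ℝ) ≤ n ^ t * n ^ d := by
    rw [← pow_add]; exact_mod_cast Nat.choose_le_pow n (t + d)
  calc (n.choose (t + d) : ℝ) * x ^ ((t + d) * (n - (t + d)))
      ≤ (n ^ t * n ^ d) * (x ^ (t * (n - t)) * x ^ (((n - 2 * t) / 2) * d)) := by
        rw [hexp, pow_add]
        have : x ^ ((n - t - (t + d)) * d) ≤ x ^ (((n - 2 * t) / 2) * d) :=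
          pow_le_pow_of_le_one hx0 hx1 (Nat.mul_le_mul_right d (by omega))
        gcongr
    _ = n ^ t * x ^ (t * (n - t)) * (n * x ^ ((n - 2 * t) / 2)) ^ d := by
        rw [mul_pow, ← pow_mul]; ring
    _ ≤ _ := mul_le_of_le_one_right (by positivity) (pow_le_one₀ (by positivity) hn)

lemma PrGnp_midCut_le {t : ℕ} {p : ℝ} (hp0 : 0 ≤ p) (hp1 : p ≤ 1)
    (hn : n * (1 - p / 2) ^ ((n - 2 * t) / 2) ≤ 1) :
    PrGnp n p (MidCut n t) ≤ (n + 1) * (n ^ t * (1 - p / 2) ^ (t * (n - t))) := by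
  have hx0 : 0 ≤ 1 - p / 2 := by linarith
  have hx1 : 1 - p / 2 ≤ 1 := by linarith
  set x := 1 - p / 2 with hx
  have hw : ∀ f : Config n, 0 ≤ ∏ e : Edge n, edgeWeight p (f e) := fun f =>
    Finset.prod_nonneg fun e _ => edgeWeight_nonneg hp0 hp1 _
  refine (prWeight_biUnion_le hw _ _).trans ?_
  have hle : ∀ S : Finset (Fin n), PrGnp n p (NoArc (S ×ˢ Sᶜ)) ≤ x ^ (S.card * (n - S.card)) := by
    intro S
    refine (PrGnp_noArc_le (y := x) ?_ hp1 (Or.inr le_rfl) (by nlinarith)).trans_eq ?_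
    · rintro ⟨u, v⟩ huv (rfl : u = v)
      simp at huv
    · rw [Finset.card_product, Finset.card_compl, Fintype.card_fin]
  refine (Finset.sum_le_sum fun S _ => hle S).trans ?_
  rw [Finset.sum_filter, ← Finset.powerset_univ]
  have h := Finset.sum_powerset_apply_card
    (fun j => if t ≤ j ∧ j + t ≤ n then x ^ (j * (n - j)) else 0)
    (x := (Finset.univ : Finset (Fin n)))
  rw [h, Finset.card_univ, Fintype.card_fin]
  have hconst : ∑ _j ∈ Finset.range (n + 1), ((n : ℝ) ^ t * x ^ (t * (n - t))) =
      (n + 1) * (n ^ t * x ^ (t * (n - t))) := by simp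
  rw [← hconst]
  refine Finset.sum_le_sum fun j hj => ?_
  rw [Finset.mem_range] at hj
  rw [nsmul_eq_mul]
  split_ifs with htj
  · rcases le_total (2 * j) n with h2 | h2
    · exact choose_mul_pow_le hx0 hx1 htj.1 h2 hn
    · have := choose_mul_pow_le (i := n - j) hx0 hx1 (by omega) (by omega) hn
      rwa [Nat.choose_symm (by omega), show n - (n - j) = j by omega, mul_comm (n - j)] at this
  · rw [mul_zero]; positivity

/-- The event that no arc goes from outside `F` to `P`, nor from `Q` to outside `F`. -/
def CrossFree (F P Q : Finset (Fin n)) : Set (Config n) := NoArc (Fᶜ ×ˢ P ∪ Q ×ˢ Fᶜ)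

lemma card_cross {F P Q : Finset (Fin n)} (hQ : Q ⊆ F) :
    (Fᶜ ×ˢ P ∪ Q ×ˢ Fᶜ).card = (P.card + Q.card) * (n - F.card) := by
  rw [Finset.card_union_of_disjoint, Finset.card_product, Finset.card_product, Finset.card_compl,
    Fintype.card_fin]
  · ring
  · rw [Finset.disjoint_left]
    rintro ⟨u, v⟩ h h'
    simp only [Finset.mem_product, Finset.mem_compl] at h h'
    exact h.1 (hQ h'.1)

lemma ne_of_mem_cross {F P Q : Finset (Fin n)} (hP : P ⊆ F) (hQ : Q ⊆ F) :
    ∀ a ∈ (Fᶜ ×ˢ P ∪ Q ×ˢ Fᶜ), a.1 ≠ a.2 := by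
  rintro ⟨u, v⟩ h (rfl : u = v)
  simp only [Finset.mem_union, Finset.mem_product, Finset.mem_compl] at h
  rcases h with h | h
  · exact h.1 (hP h.2)
  · exact h.2 (hQ h.1)

lemma PrGnp_crossFree_le {F P Q : Finset (Fin n)} (hP : P ⊆ F) (hQ : Q ⊆ F) {p : ℝ} {c : ℕ}
    (hp0 : 0 ≤ p) (hp1 : p ≤ 1) (hF : F.card ≤ c) :
    PrGnp n p (CrossFree F P Q) ≤ (1 - p / 2) ^ ((P.card + Q.card) * (n - c)) := by
  refine (PrGnp_noArc_le (y := 1 - p / 2) (ne_of_mem_cross hP hQ) hp1 (Or.inr le_rfl)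
    (by nlinarith)).trans ?_
  rw [card_cross hQ]
  exact pow_le_pow_of_le_one (by linarith) (by linarith) (by gcongr)

lemma PrGnp_crossFree_self_le {F P : Finset (Fin n)} (hP : P ⊆ F) {p : ℝ} {c : ℕ}
    (hp0 : 0 ≤ p) (hp1 : p ≤ 1) (hF : F.card ≤ c) :
    PrGnp n p (CrossFree F P P) ≤ (1 - p) ^ (P.card * (n - c)) := by
  have h1 : 0 ≤ 1 - p := by linarith
  refine (PrGnp_noArc_le (y := √(1 - p)) (ne_of_mem_cross hP hP) hp1 (Or.inl ?_)
    (Real.sq_sqrt h1).ge).trans ?_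
  · rintro ⟨u, v⟩ h
    simp only [Finset.mem_union, Finset.mem_product, Prod.swap_prod_mk] at h ⊢
    tauto
  · rw [card_cross hP, ← two_mul, mul_assoc, pow_mul, Real.sq_sqrt h1]
    exact pow_le_pow_of_le_one h1 (by linarith) (by gcongr)

lemma eq_singleton_of_card_le_one {S : Finset (Fin n)} {x : Fin n} (hx : x ∈ S)
    (hS : S.card ≤ 1) : S = {x} :=
  Finset.eq_singleton_iff_unique_mem.2 ⟨hx, fun _ hy => Finset.card_le_one.1 hS _ hy _ hx⟩

lemma eq_singleton_or_pair {S : Finset (Fin n)} {x : Fin n} (hx : x ∈ S) (hS : S.card ≤ 2) :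
    S = {x} ∨ ∃ u, u ≠ x ∧ S = {x, u} := by
  have h1 : 1 ≤ S.card := Finset.card_pos.2 ⟨x, hx⟩
  have h2 : (S.erase x).card ≤ 1 := by rw [Finset.card_erase_of_mem hx]; omega
  rcases Nat.le_one_iff_eq_zero_or_eq_one.1 h2 with h | h
  · left
    rw [← Finset.insert_erase hx, Finset.card_eq_zero.1 h]; simp
  · right
    obtain ⟨u, hu⟩ := Finset.card_eq_one.1 h
    refine ⟨u, ?_, by rw [← Finset.insert_erase hx, hu]⟩
    have : u ∈ S.erase x := by rw [hu]; simp
    exact (Finset.mem_erase.1 this).1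

lemma eq_pair_of_card_le_two {S : Finset (Fin n)} {x y : Fin n} (hxy : x ≠ y) (hx : x ∈ S)
    (hy : y ∈ S) (hS : S.card ≤ 2) : S = {x, y} := by
  refine (Finset.eq_of_subset_of_card_le ?_ ?_).symm
  · intro z hz
    rcases Finset.mem_insert.1 hz with rfl | hz
    · exact hx
    · rwa [Finset.mem_singleton.1 hz]
  · rw [Finset.card_pair hxy]; exact hS

lemma noArc_union (A B : Finset (Fin n × Fin n)) : NoArc (A ∪ B) = NoArc A ∩ NoArc B := by
  ext f
  simp only [NoArc, Set.mem_ofPred_eq, Set.mem_inter_iff, Finset.mem_union]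
  exact ⟨fun h => ⟨fun a ha => h a (Or.inl ha), fun a ha => h a (Or.inr ha)⟩,
    fun h a ha => ha.elim (h.1 a) (h.2 a)⟩

lemma noArc_mono {A B : Finset (Fin n × Fin n)} (h : A ⊆ B) : NoArc B ⊆ NoArc A :=
  fun _ hf a ha => hf a (h ha)

lemma mem_midCut {t : ℕ} {f : Config n} {S : Finset (Fin n)} (hS : f ∈ NoArc (S ×ˢ Sᶜ))
    (h1 : t ≤ S.card) (h2 : S.card + t ≤ n) : f ∈ MidCut n t :=
  Set.mem_biUnion (Finset.mem_coe.2 (Finset.mem_filter.2 ⟨Finset.mem_univ _, h1, h2⟩)) hS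

lemma not_reaches_subset (s a : Fin n) :
    {f | ¬ Reaches f s a} ⊆
      (NoArc ({s} ×ˢ {s}ᶜ) ∪ NoArc ({a}ᶜ ×ˢ {a})) ∪ MidCut n 2 := by
  intro f hf
  obtain ⟨S, hs, ha, hS⟩ := not_reaches_iff.1 hf
  have hc := Finset.card_add_card_compl S
  rw [Fintype.card_fin] at hc
  by_cases h1 : S.card ≤ 1
  · rw [eq_singleton_of_card_le_one hs h1] at hS
    exact Or.inl (Or.inl hS)
  by_cases h2 : Sᶜ.card ≤ 1
  · rw [← compl_compl S, eq_singleton_of_card_le_one (Finset.mem_compl.2 ha) h2,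
      compl_compl] at hS
    exact Or.inl (Or.inr hS)
  · exact Or.inr (mem_midCut hS (by omega) (by omega))

lemma noArc_out_subset {s a : Fin n} (h : s ≠ a) :
    NoArc ({s} ×ˢ {s}ᶜ) ⊆ {f | ¬ Reaches f s a} := fun _ hf =>
  not_reaches_iff.2 ⟨{s}, by simp, by simpa using h.symm, hf⟩

lemma noArc_in_subset {s a : Fin n} (h : s ≠ a) :
    NoArc ({a}ᶜ ×ˢ {a}) ⊆ {f | ¬ Reaches f s a} := fun _ hf =>
  not_reaches_iff.2 ⟨{a}ᶜ, by simpa using h, by simp, by simpa using hf⟩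

/-- The union of the negligible events for the joint event `s ↛ a`, `b ↛ s`. -/
def Exceptional (s a b : Fin n) : Set (Config n) :=
  (MidCut n 3 ∪ ⋃ z ∈ (Finset.univ : Finset (Fin n × Fin n)), CrossFree {s, z.1, z.2} {s} {s}) ∪
    ((⋃ z ∈ (Finset.univ.filter fun z : Fin n × Fin n => z.1 ≠ a),
      CrossFree {a, b, z.1, z.2} {a, z.1} {b}) ∪
    (⋃ z ∈ (Finset.univ.filter fun z : Fin n × Fin n => z.2 ≠ b),
      CrossFree {a, b, z.1, z.2} {a} {b, z.2}))

/-- The arcs leaving `{s, b}`, together with `b → s`. -/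
def arcsOut (s b : Fin n) : Finset (Fin n × Fin n) := insert (b, s) ({s, b} ×ˢ {s, b}ᶜ)

/-- The arcs entering `{a, s}`, together with `s → a`. -/
def arcsIn (s a : Fin n) : Finset (Fin n × Fin n) := insert (s, a) ({a, s}ᶜ ×ˢ {a, s})

/-- The arcs entering `a` or leaving `b`. -/
def arcsInOut (a b : Fin n) : Finset (Fin n × Fin n) := {a}ᶜ ×ˢ {a} ∪ {b} ×ˢ {b}ᶜ

lemma mem_noArc_inter {f : Config n} {S T : Finset (Fin n)} (hS : f ∈ NoArc (S ×ˢ Sᶜ))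
    (hT : f ∈ NoArc (T ×ˢ Tᶜ)) : f ∈ NoArc ((S ∩ T) ×ˢ (S ∩ T)ᶜ) := by
  rintro ⟨u, v⟩ huv
  simp only [Finset.mem_product, Finset.mem_compl, Finset.mem_inter, not_and_or] at huv
  rcases huv.2 with h | h
  · exact hS (u, v) (by simpa using ⟨huv.1.1, h⟩)
  · exact hT (u, v) (by simpa using ⟨huv.1.2, h⟩)

lemma mem_noArc_union {f : Config n} {S T : Finset (Fin n)} (hS : f ∈ NoArc (S ×ˢ Sᶜ))
    (hT : f ∈ NoArc (T ×ˢ Tᶜ)) : f ∈ NoArc ((S ∪ T) ×ˢ (S ∪ T)ᶜ) := by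
  rintro ⟨u, v⟩ huv
  simp only [Finset.mem_product, Finset.mem_compl, Finset.mem_union, not_or] at huv
  rcases huv.1 with h | h
  · exact hS (u, v) (by simpa using ⟨h, huv.2.1⟩)
  · exact hT (u, v) (by simpa using ⟨h, huv.2.2⟩)

lemma crossFree_source_subset (s a b u v : Fin n) :
    CrossFree {s, u, v} {s} {s} ⊆ Exceptional s a b := fun _ hf =>
  Or.inl (Or.inr (Set.mem_biUnion (x := (u, v)) (by simp) hf))

lemma crossFree_in_subset (s a b : Fin n) {u : Fin n} (v : Fin n) (hu : u ≠ a) :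
    CrossFree {a, b, u, v} {a, u} {b} ⊆ Exceptional s a b := fun _ hf =>
  Or.inr (Or.inl (Set.mem_biUnion (x := (u, v)) (by simpa using hu) hf))

lemma crossFree_out_subset (s a b u : Fin n) {v : Fin n} (hv : v ≠ b) :
    CrossFree {a, b, u, v} {a} {b, v} ⊆ Exceptional s a b := fun _ hf =>
  Or.inr (Or.inr (Set.mem_biUnion (x := (u, v)) (by simpa using hv) hf))

lemma not_reaches_and_subset {s a b : Fin n} (hsa : s ≠ a) (hsb : s ≠ b) (hn : 7 ≤ n) :
    {f | ¬ Reaches f s a ∧ ¬ Reaches f b s} ⊆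
      ((NoArc (arcsOut s b) ∪ NoArc (arcsIn s a)) ∪ NoArc (arcsInOut a b)) ∪
        Exceptional s a b := by
  rintro f ⟨h1, h2⟩
  by_cases hmid : f ∈ MidCut n 3
  · exact Or.inr (Or.inl (Or.inl hmid))
  have hsmall : ∀ S : Finset (Fin n), f ∈ NoArc (S ×ˢ Sᶜ) → S.card ≤ 2 ∨ Sᶜ.card ≤ 2 := by
    intro S hS
    by_contra! h
    have hc := Finset.card_add_card_compl S
    rw [Fintype.card_fin] at hc
    exact hmid (mem_midCut hS (by omega) (by omega))
  obtain ⟨S, hs, ha, hS⟩ := not_reaches_iff.1 h1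
  obtain ⟨T, hb, hs', hT⟩ := not_reaches_iff.1 h2
  have hcompl : ∀ U : Finset (Fin n), U.card + Uᶜ.card = n := fun U => by
    rw [Finset.card_add_card_compl, Fintype.card_fin]
  rcases hsmall S hS with hS2 | hS2 <;> rcases hsmall T hT with hT2 | hT2
  · have hU := mem_noArc_union hS hT
    have h4 := Finset.card_union_le S T
    have hU2 : (S ∪ T).card ≤ 2 := by
      rcases hsmall _ hU with h | h
      · exact h
      · have := hcompl (S ∪ T); omega
    rw [eq_pair_of_card_le_two hsb (Finset.mem_union_left _ hs) (Finset.mem_union_right _ hb) hU2]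
      at hU
    refine Or.inl (Or.inl (Or.inl fun x hx => ?_))
    rcases Finset.mem_insert.1 hx with rfl | hx
    · exact hT (b, s) (by simpa using ⟨hb, hs'⟩)
    · exact hU x hx
  · refine Or.inr ?_
    have hsub : ∀ U : Finset (Fin n), s ∈ U → U.card ≤ 2 → ∃ u, ∀ w ∈ U, w = s ∨ w = u := by
      intro U hsU hU2
      rcases eq_singleton_or_pair hsU hU2 with h | ⟨u, _, h⟩
      · exact ⟨s, by simp [h]⟩
      · exact ⟨u, by simp [h]⟩
    obtain ⟨u, hu⟩ := hsub S hs hS2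
    obtain ⟨v, hv⟩ := hsub Tᶜ (Finset.mem_compl.2 hs') hT2
    refine crossFree_source_subset s a b u v ?_
    rintro ⟨x, y⟩ hxy
    simp only [Finset.mem_union, Finset.mem_product, Finset.mem_compl, Finset.mem_insert,
      Finset.mem_singleton, not_or] at hxy
    rcases hxy with ⟨⟨hx1, -, hx3⟩, rfl⟩ | ⟨rfl, hy1, hy2, -⟩
    · refine hT (x, y) (Finset.mem_product.2 ⟨?_, Finset.mem_compl.2 hs'⟩)
      by_contra hx
      exact (hv x (Finset.mem_compl.2 hx)).elim hx1 hx3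
    · refine hS (x, y) (Finset.mem_product.2 ⟨hs, Finset.mem_compl.2 fun hy => ?_⟩)
      exact (hu y hy).elim hy1 hy2
  · have haS := Finset.mem_compl.2 ha
    rcases eq_singleton_or_pair haS hS2 with h | ⟨u, hu, h⟩
    · rcases eq_singleton_or_pair hb hT2 with h' | ⟨v, hv, h'⟩
      · refine Or.inl (Or.inr ?_)
        rw [arcsInOut, noArc_union]
        rw [← compl_compl S, h, compl_compl] at hS
        rw [h'] at hT
        exact ⟨hS, hT⟩
      · refine Or.inr (crossFree_out_subset s a b a hv ?_)
        rintro ⟨x, y⟩ hxy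
        simp only [Finset.mem_union, Finset.mem_product, Finset.mem_compl, Finset.mem_insert,
          Finset.mem_singleton, not_or] at hxy
        rcases hxy with ⟨⟨hx, -⟩, rfl⟩ | ⟨hx, -, hy1, -, hy2⟩
        · refine hS (x, y) (Finset.mem_product.2 ⟨?_, haS⟩)
          rw [← compl_compl S, h]; simpa using hx
        · refine hT (x, y) (Finset.mem_product.2 ⟨?_, ?_⟩)
          · rw [h']; simpa using hx
          · rw [h']; simpa using ⟨hy1, hy2⟩
    · have hv : ∃ v, ∀ w ∈ T, w = b ∨ w = v := by
        rcases eq_singleton_or_pair hb hT2 with h' | ⟨v, _, h'⟩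
        · exact ⟨b, by simp [h']⟩
        · exact ⟨v, by simp [h']⟩
      obtain ⟨v, hv⟩ := hv
      refine Or.inr (crossFree_in_subset s a b v hu ?_)
      rintro ⟨x, y⟩ hxy
      simp only [Finset.mem_union, Finset.mem_product, Finset.mem_compl, Finset.mem_insert,
        Finset.mem_singleton, not_or] at hxy
      rcases hxy with ⟨⟨hx1, -, hx2, -⟩, hy⟩ | ⟨rfl, -, hy1, -, hy2⟩
      · refine hS (x, y) (Finset.mem_product.2 ⟨?_, ?_⟩)
        · rw [← compl_compl S, h]; simpa using ⟨hx1, hx2⟩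
        · rw [h]; simpa using hy
      · refine hT (x, y) (Finset.mem_product.2 ⟨hb, Finset.mem_compl.2 fun hy => ?_⟩)
        exact (hv y hy).elim hy1 hy2
  · have hU := mem_noArc_inter hS hT
    have h4 := Finset.card_union_le Sᶜ Tᶜ
    rw [← Finset.compl_inter] at h4
    have hU2 : (S ∩ T)ᶜ.card ≤ 2 := by
      rcases hsmall _ hU with h | h
      · have := hcompl (S ∩ T); omega
      · exact h
    have hpair := eq_pair_of_card_le_two hsa.symm (S := (S ∩ T)ᶜ) (by simp [ha]) (by simp [hs']) hU2
    rw [← compl_compl (S ∩ T), hpair, compl_compl] at hU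
    refine Or.inl (Or.inl (Or.inr fun x hx => ?_))
    rcases Finset.mem_insert.1 hx with rfl | hx
    · exact hS (s, a) (by simpa using ⟨hs, ha⟩)
    · exact hU x hx

lemma noArc_arcsOut_subset {s a b : Fin n} (hsa : s ≠ a) (hsb : s ≠ b) (hab : a ≠ b) :
    NoArc (arcsOut s b) ⊆ {f | ¬ Reaches f s a ∧ ¬ Reaches f b s} := by
  refine fun f hf => ⟨not_reaches_iff.2 ⟨{s, b}, by simp, by simp [hsa.symm, hab],
    noArc_mono (Finset.subset_insert _ _) hf⟩, not_reaches_iff.2 ⟨{b}, by simp, by simpa using hsb,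
    noArc_mono ?_ hf⟩⟩
  rintro ⟨x, y⟩ hxy
  simp only [arcsOut, Finset.mem_product, Finset.mem_compl, Finset.mem_insert,
    Finset.mem_singleton, Prod.mk.injEq] at hxy ⊢
  tauto

lemma noArc_arcsIn_subset {s a b : Fin n} (hsa : s ≠ a) (hsb : s ≠ b) (hab : a ≠ b) :
    NoArc (arcsIn s a) ⊆ {f | ¬ Reaches f s a ∧ ¬ Reaches f b s} := by
  refine fun f hf => ⟨not_reaches_iff.2 ⟨{a}ᶜ, by simpa using hsa, by simp, noArc_mono ?_ hf⟩,
    not_reaches_iff.2 ⟨{a, s}ᶜ, by simp [hab.symm, hsb.symm], by simp, noArc_mono ?_ hf⟩⟩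
  · rintro ⟨x, y⟩ hxy
    simp only [arcsIn, Finset.mem_product, Finset.mem_compl, Finset.mem_insert,
      Finset.mem_singleton, Prod.mk.injEq, not_not] at hxy ⊢
    tauto
  · rw [compl_compl]
    exact Finset.subset_insert _ _

lemma noArc_arcsInOut_subset {s a b : Fin n} (hsa : s ≠ a) (hsb : s ≠ b) :
    NoArc (arcsInOut a b) ⊆ {f | ¬ Reaches f s a ∧ ¬ Reaches f b s} := by
  intro f hf
  rw [arcsInOut, noArc_union] at hf
  exact ⟨noArc_in_subset hsa hf.1, noArc_out_subset hsb.symm hf.2⟩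

lemma noArc_arcsOut_inter_arcsIn (s a b : Fin n) :
    NoArc (arcsOut s b) ∩ NoArc (arcsIn s a) ⊆ Exceptional s a b := by
  rw [← noArc_union]
  refine (noArc_mono ?_).trans (crossFree_source_subset s a b a b)
  rintro ⟨x, y⟩ hxy
  simp only [arcsOut, arcsIn, Finset.mem_union, Finset.mem_product, Finset.mem_compl,
    Finset.mem_insert, Finset.mem_singleton, Prod.mk.injEq] at hxy ⊢
  tauto

lemma noArc_arcsOut_inter_arcsInOut {s a b : Fin n} (hsb : s ≠ b) :
    NoArc (arcsOut s b) ∩ NoArc (arcsInOut a b) ⊆ Exceptional s a b := by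
  rw [← noArc_union]
  refine (noArc_mono ?_).trans (crossFree_out_subset s a b a hsb)
  rintro ⟨x, y⟩ hxy
  simp only [arcsOut, arcsInOut, Finset.mem_union, Finset.mem_product, Finset.mem_compl,
    Finset.mem_insert, Finset.mem_singleton, Prod.mk.injEq] at hxy ⊢
  tauto

lemma noArc_arcsIn_inter_arcsInOut {s a b : Fin n} (hsa : s ≠ a) :
    NoArc (arcsIn s a) ∩ NoArc (arcsInOut a b) ⊆ Exceptional s a b := by
  rw [← noArc_union]
  refine (noArc_mono ?_).trans (crossFree_in_subset s a b a hsa)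
  rintro ⟨x, y⟩ hxy
  simp only [arcsIn, arcsInOut, Finset.mem_union, Finset.mem_product, Finset.mem_compl,
    Finset.mem_insert, Finset.mem_singleton, Prod.mk.injEq] at hxy ⊢
  tauto

end Cuts

lemma prWeight_add_le {α : Type*} [Fintype α] {w : α → ℝ} (hw : ∀ x, 0 ≤ w x)
    {E F G R : Set α} (hE : E ⊆ G) (hF : F ⊆ G) (hR : E ∩ F ⊆ R) :
    prWeight w E + prWeight w F ≤ prWeight w G + prWeight w R := by
  have h : prWeight w E + prWeight w F = prWeight w (E ∪ F) + prWeight w (E ∩ F) := by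
    simp only [prWeight, ← Finset.sum_add_distrib]
    exact Finset.sum_congr rfl fun x _ => (congrFun (Set.indicator_union_add_inter w E F) x).symm
  rw [h]
  exact add_le_add (prWeight_mono hw (Set.union_subset hE hF)) (prWeight_mono hw hR)

section Estimates
variable {n m : ℕ} {p : ℝ}

lemma PrGnm_weight_nonneg (n m : ℕ) (f : Config n) :
    0 ≤ if edgeCount f = m then ((Nat.choose (Nat.choose n 2) m : ℝ) * 2 ^ m)⁻¹ else 0 := by
  split_ifs <;> positivity

lemma PrGnm_noArc_out (s : Fin n) (m : ℕ) :
    PrGnm n m (NoArc ({s} ×ˢ {s}ᶜ)) = avoidProb (n.choose 2) m (n - 1) := by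
  rw [PrGnm_noArc, Finset.card_product, Finset.card_compl, Fintype.card_fin,
    Finset.card_singleton, one_mul]
  · rintro ⟨x, y⟩ hxy (rfl : x = y)
    simp only [Finset.mem_product, Finset.mem_compl, Finset.mem_singleton] at hxy
    tauto
  · rintro ⟨x, y⟩ hxy hyx
    simp only [Finset.mem_product, Finset.mem_compl, Finset.mem_singleton, Prod.swap] at hxy hyx
    tauto

lemma PrGnm_noArc_in (a : Fin n) (m : ℕ) :
    PrGnm n m (NoArc ({a}ᶜ ×ˢ {a})) = avoidProb (n.choose 2) m (n - 1) := by
  rw [PrGnm_noArc, Finset.card_product, Finset.card_compl, Fintype.card_fin,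
    Finset.card_singleton, mul_one]
  · rintro ⟨x, y⟩ hxy (rfl : x = y)
    simp only [Finset.mem_product, Finset.mem_compl, Finset.mem_singleton] at hxy
    tauto
  · rintro ⟨x, y⟩ hxy hyx
    simp only [Finset.mem_product, Finset.mem_compl, Finset.mem_singleton, Prod.swap] at hxy hyx
    tauto

lemma card_arcsOut {s b : Fin n} (h : s ≠ b) (hn : 2 ≤ n) : (arcsOut s b).card = 2 * n - 3 := by
  rw [arcsOut, Finset.card_insert_of_notMem (by simp), Finset.card_product, Finset.card_compl,
    Fintype.card_fin, Finset.card_pair h]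
  omega

lemma card_arcsIn {s a : Fin n} (h : s ≠ a) (hn : 2 ≤ n) : (arcsIn s a).card = 2 * n - 3 := by
  rw [arcsIn, Finset.card_insert_of_notMem (by simp), Finset.card_product, Finset.card_compl,
    Fintype.card_fin, Finset.card_pair h.symm]
  omega

lemma card_arcsInOut {a b : Fin n} (h : a ≠ b) (hn : 2 ≤ n) :
    (arcsInOut a b).card = 2 * n - 3 := by
  have h1 : ({a}ᶜ ×ˢ {a} ∩ {b} ×ˢ {b}ᶜ : Finset (Fin n × Fin n)) = {(b, a)} := by
    ext ⟨x, y⟩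
    simp only [Finset.mem_inter, Finset.mem_product, Finset.mem_compl, Finset.mem_singleton,
      Prod.mk.injEq]
    constructor
    · rintro ⟨⟨-, rfl⟩, rfl, -⟩; exact ⟨rfl, rfl⟩
    · rintro ⟨rfl, rfl⟩; exact ⟨⟨h.symm, rfl⟩, rfl, h⟩
  have h2 := Finset.card_union_add_card_inter ({a}ᶜ ×ˢ {a} : Finset (Fin n × Fin n)) ({b} ×ˢ {b}ᶜ)
  rw [h1, Finset.card_singleton, Finset.card_product, Finset.card_product, Finset.card_compl,
    Finset.card_compl, Fintype.card_fin, Finset.card_singleton, Finset.card_singleton] at h2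
  rw [arcsInOut]
  omega

lemma ne_of_mem_arcsInOut {a b : Fin n} : ∀ x ∈ arcsInOut a b, x.1 ≠ x.2 := by
  rintro ⟨x, y⟩ hxy (rfl : x = y)
  simp only [arcsInOut, Finset.mem_union, Finset.mem_product, Finset.mem_compl,
    Finset.mem_singleton] at hxy
  tauto

lemma PrGnm_arcsOut {s b : Fin n} (h : s ≠ b) (hn : 2 ≤ n) :
    PrGnm n m (NoArc (arcsOut s b)) = avoidProb (n.choose 2) m (2 * n - 3) := by
  rw [PrGnm_noArc, card_arcsOut h hn]
  · rintro ⟨x, y⟩ hxy (rfl : x = y)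
    simp only [arcsOut, Finset.mem_insert, Finset.mem_product, Finset.mem_compl,
      Finset.mem_singleton, Prod.mk.injEq] at hxy
    rcases hxy with ⟨rfl, h'⟩ | hxy
    · exact h h'.symm
    · tauto
  · rintro ⟨x, y⟩ hxy hyx
    simp only [arcsOut, Finset.mem_insert, Finset.mem_product, Finset.mem_compl,
      Finset.mem_singleton, Prod.mk.injEq, Prod.swap] at hxy hyx
    grind

lemma PrGnm_arcsIn {s a : Fin n} (h : s ≠ a) (hn : 2 ≤ n) :
    PrGnm n m (NoArc (arcsIn s a)) = avoidProb (n.choose 2) m (2 * n - 3) := by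
  rw [PrGnm_noArc, card_arcsIn h hn]
  · rintro ⟨x, y⟩ hxy (rfl : x = y)
    simp only [arcsIn, Finset.mem_insert, Finset.mem_product, Finset.mem_compl,
      Finset.mem_singleton, Prod.mk.injEq] at hxy
    rcases hxy with ⟨rfl, h'⟩ | hxy
    · exact h h'
    · tauto
  · rintro ⟨x, y⟩ hxy hyx
    simp only [arcsIn, Finset.mem_insert, Finset.mem_product, Finset.mem_compl,
      Finset.mem_singleton, Prod.mk.injEq, Prod.swap] at hxy hyx
    grind

lemma PrGnm_arcsInOut {a b : Fin n} (h : a ≠ b) (hn : 2 ≤ n) :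
    PrGnm n m (NoArc (arcsInOut a b)) = avoidProb (n.choose 2) m (2 * n - 3) := by
  rw [PrGnm_noArc ne_of_mem_arcsInOut, card_arcsInOut h hn]
  rintro ⟨x, y⟩ hxy hyx
  simp only [arcsInOut, Finset.mem_union, Finset.mem_product, Finset.mem_compl,
    Finset.mem_singleton, Prod.swap] at hxy hyx
  grind

/-- Non-reachability in the uniform model is dominated by `s` having no out-neighbour or `a` having
no in-neighbour. -/
lemma abs_PrGnm_not_reaches_sub_le {s a : Fin n} (hsa : s ≠ a) (hn : 2 ≤ n)
    (hm : m ≤ n.choose 2) (hp0 : 0 ≤ p) (hp1 : p ≤ 1) (hp : n.choose 2 * p = m)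
    (hlarge : n * (1 - p / 2) ^ ((n - 2 * 2) / 2) ≤ 1) :
    |PrGnm n m {f | ¬ Reaches f s a} - 2 * avoidProb (n.choose 2) m (n - 1)| ≤
      (n.choose 2 + 1) * ((1 - p / 2) ^ (2 * n - 3) +
        (n + 1) * (n ^ 2 * (1 - p / 2) ^ (2 * (n - 2)))) := by
  have hw := PrGnm_weight_nonneg n m
  have hx0 : 0 ≤ 1 - p / 2 := by linarith
  have hup : PrGnm n m {f | ¬ Reaches f s a} ≤ _ := prWeight_mono hw (not_reaches_subset s a)
  have hlow := prWeight_add_le hw (noArc_in_subset hsa) (noArc_out_subset hsa)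
    (R := NoArc (arcsInOut a s)) (by rw [arcsInOut, noArc_union])
  have hmid := (PrGnm_le_PrGnp hm hp0 hp1 hp (MidCut n 2)).trans
    (mul_le_mul_of_nonneg_left (PrGnp_midCut_le hp0 hp1 hlarge) (by positivity))
  have hio := (PrGnm_le_PrGnp hm hp0 hp1 hp (NoArc (arcsInOut a s))).trans
    (mul_le_mul_of_nonneg_left (PrGnp_noArc_le (y := 1 - p / 2) ne_of_mem_arcsInOut hp1
      (Or.inr le_rfl) (by nlinarith)) (by positivity))
  rw [card_arcsInOut hsa.symm hn] at hio
  have hu1 := prWeight_union_le hw (NoArc ({s} ×ˢ {s}ᶜ) ∪ NoArc ({a}ᶜ ×ˢ {a})) (MidCut n 2)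
  have hu2 := prWeight_union_le hw (NoArc ({s} ×ˢ {s}ᶜ)) (NoArc ({a}ᶜ ×ˢ {a}))
  have ho := PrGnm_noArc_out s m
  have hi := PrGnm_noArc_in a m
  unfold PrGnm at *
  have h1 : 0 ≤ ((n.choose 2 : ℝ) + 1) * (1 - p / 2) ^ (2 * n - 3) := by positivity
  have h2 : 0 ≤ ((n.choose 2 : ℝ) + 1) * ((n + 1) * (n ^ 2 * (1 - p / 2) ^ (2 * (n - 2)))) := by
    positivity
  rw [mul_add, abs_le]
  constructor <;> linarith

lemma PrGnp_exceptional_le {s a b : Fin n} (hp0 : 0 ≤ p) (hp1 : p ≤ 1)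
    (hlarge : n * (1 - p / 2) ^ ((n - 2 * 3) / 2) ≤ 1) :
    PrGnp n p (Exceptional s a b) ≤
      (n + 1) * (n ^ 3 * (1 - p / 2) ^ (3 * (n - 3))) + n ^ 2 * (1 - p) ^ (n - 3) +
        2 * (n ^ 2 * (1 - p / 2) ^ (3 * (n - 4))) := by
  have hw : ∀ f : Config n, 0 ≤ ∏ e : Edge n, edgeWeight p (f e) := fun f =>
    Finset.prod_nonneg fun e _ => edgeWeight_nonneg hp0 hp1 _
  have hx0 : 0 ≤ 1 - p / 2 := by linarith
  have hbound : ∀ (I : Finset (Fin n × Fin n)) (E : Fin n × Fin n → Set (Config n)) (c : ℝ),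
      0 ≤ c → (∀ z ∈ I, PrGnp n p (E z) ≤ c) → PrGnp n p (⋃ z ∈ I, E z) ≤ n ^ 2 * c := by
    intro I E c hc hE
    refine (prWeight_biUnion_le hw I E).trans ((Finset.sum_le_card_nsmul I _ c hE).trans ?_)
    rw [nsmul_eq_mul]
    have : (I.card : ℝ) ≤ n ^ 2 := by
      have := Finset.card_le_univ I
      rw [Fintype.card_prod, Fintype.card_fin, ← sq] at this
      exact_mod_cast this
    gcongr
  have hiso := hbound Finset.univ (fun z => CrossFree {s, z.1, z.2} {s} {s}) ((1 - p) ^ (n - 3))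
    (pow_nonneg (by linarith) _) fun z _ =>
      (PrGnp_crossFree_self_le (c := 3) (by simp) hp0 hp1 Finset.card_le_three).trans_eq (by simp)
  have hin := hbound (Finset.univ.filter fun z : Fin n × Fin n => z.1 ≠ a)
    (fun z => CrossFree {a, b, z.1, z.2} {a, z.1} {b}) ((1 - p / 2) ^ (3 * (n - 4)))
    (by positivity) fun z hz => by
      refine (PrGnp_crossFree_le (c := 4) ?_ (by simp) hp0 hp1 Finset.card_le_four).trans_eq ?_
      · intro w; simp only [Finset.mem_insert, Finset.mem_singleton]; tauto
      · rw [Finset.card_pair (Finset.mem_filter.1 hz).2.symm, Finset.card_singleton]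
  have hout := hbound (Finset.univ.filter fun z : Fin n × Fin n => z.2 ≠ b)
    (fun z => CrossFree {a, b, z.1, z.2} {a} {b, z.2}) ((1 - p / 2) ^ (3 * (n - 4)))
    (by positivity) fun z hz => by
      refine (PrGnp_crossFree_le (c := 4) (by simp) ?_ hp0 hp1 Finset.card_le_four).trans_eq ?_
      · intro w; simp only [Finset.mem_insert, Finset.mem_singleton]; tauto
      · rw [Finset.card_pair (Finset.mem_filter.1 hz).2.symm, Finset.card_singleton]
  have hmid := PrGnp_midCut_le (n := n) (t := 3) hp0 hp1 hlarge
  unfold Exceptional PrGnp at *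
  refine (prWeight_union_le hw _ _).trans ?_
  have h1 := prWeight_union_le hw (MidCut n 3)
    (⋃ z ∈ (Finset.univ : Finset (Fin n × Fin n)), CrossFree {s, z.1, z.2} {s} {s})
  have h2 := prWeight_union_le hw
    (⋃ z ∈ (Finset.univ.filter fun z : Fin n × Fin n => z.1 ≠ a),
      CrossFree {a, b, z.1, z.2} {a, z.1} {b})
    (⋃ z ∈ (Finset.univ.filter fun z : Fin n × Fin n => z.2 ≠ b),
      CrossFree {a, b, z.1, z.2} {a} {b, z.2})
  linarith

/-- The joint non-reachability event is dominated by three local events, each of which forbids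
`2 * n - 3` arcs. -/
lemma abs_PrGnm_not_reaches_and_sub_le {s a b : Fin n} (hsa : s ≠ a) (hsb : s ≠ b) (hab : a ≠ b)
    (hn : 7 ≤ n) (hm : m ≤ n.choose 2) (hp0 : 0 ≤ p) (hp1 : p ≤ 1) (hp : n.choose 2 * p = m)
    (hlarge : n * (1 - p / 2) ^ ((n - 2 * 3) / 2) ≤ 1) :
    |PrGnm n m {f | ¬ Reaches f s a ∧ ¬ Reaches f b s} -
        3 * avoidProb (n.choose 2) m (2 * n - 3)| ≤
      2 * ((n.choose 2 + 1) * ((n + 1) * (n ^ 3 * (1 - p / 2) ^ (3 * (n - 3))) +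
        n ^ 2 * (1 - p) ^ (n - 3) + 2 * (n ^ 2 * (1 - p / 2) ^ (3 * (n - 4))))) := by
  have hw := PrGnm_weight_nonneg n m
  have hexc := (PrGnm_le_PrGnp hm hp0 hp1 hp (Exceptional s a b)).trans
    (mul_le_mul_of_nonneg_left (PrGnp_exceptional_le hp0 hp1 hlarge) (by positivity))
  have hexc0 := prWeight_nonneg hw (Exceptional s a b)
  have hup := prWeight_mono hw (not_reaches_and_subset (a := a) hsa hsb hn)
  have hu1 := prWeight_union_le hw
    ((NoArc (arcsOut s b) ∪ NoArc (arcsIn s a)) ∪ NoArc (arcsInOut a b)) (Exceptional s a b)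
  have hu2 := prWeight_union_le hw (NoArc (arcsOut s b) ∪ NoArc (arcsIn s a))
    (NoArc (arcsInOut a b))
  have hu3 := prWeight_union_le hw (NoArc (arcsOut s b)) (NoArc (arcsIn s a))
  have hl1 := prWeight_add_le hw Set.subset_union_left Set.subset_union_right
    (noArc_arcsOut_inter_arcsIn s a b)
  have hl2 := prWeight_add_le hw
    (Set.union_subset (noArc_arcsOut_subset hsa hsb hab) (noArc_arcsIn_subset hsa hsb hab))
    (noArc_arcsInOut_subset (a := a) hsa hsb) (R := Exceptional s a b) (by
      rw [Set.union_inter_distrib_right]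
      exact Set.union_subset (noArc_arcsOut_inter_arcsInOut hsb)
        (noArc_arcsIn_inter_arcsInOut hsa))
  have h1 := PrGnm_arcsOut (m := m) hsb (by omega)
  have h2 := PrGnm_arcsIn (m := m) hsa (by omega)
  have h3 := PrGnm_arcsInOut (m := m) hab (by omega)
  unfold PrGnm at *
  rw [abs_le]
  constructor <;> linarith

end Estimates

section Asymptotics

lemma abs_exp_sub_exp_le {a b : ℝ} (ha : a ≤ 0) (hb : b ≤ 0) : |exp a - exp b| ≤ |a - b| := by
  wlog h : b ≤ a generalizing a b
  · rw [abs_sub_comm, abs_sub_comm a]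
    exact this hb ha (le_of_not_ge h)
  rw [abs_of_nonneg (sub_nonneg.2 (exp_le_exp.2 h)), abs_of_nonneg (sub_nonneg.2 h)]
  have h1 : exp b = exp a * exp (b - a) := by rw [← exp_add]; ring_nf
  have h2 := add_one_le_exp (b - a)
  have h3 : exp a ≤ 1 := exp_le_one_iff.2 ha
  have h4 := exp_pos a
  nlinarith

lemma cast_choose_two_eq (n : ℕ) :
    (((n + 3).choose 2 : ℕ) : ℝ) = ((n : ℝ) + 3) * (n + 2) / 2 := by
  rw [Nat.cast_choose_two]
  push_cast
  ring

lemma abs_avoidProb_div_pow_sub_le {n m k : ℕ} {p j : ℝ} (hn : 6 ≤ n)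
    (hm : m ≤ (n + 3).choose 2) (hp : p = m / (n + 3).choose 2) (hp0 : 0 ≤ p) (hp1 : p ≤ 1)
    (hk : k ≤ 2 * n + 3) (hj0 : 0 ≤ j)
    (hj : |(k : ℝ) ^ 2 / (2 * (n + 3).choose 2) - j| ≤ 8 / ((n : ℝ) + 3)) :
    |avoidProb ((n + 3).choose 2) m k / (1 - p / 2) ^ k - exp (-(p * (1 - p) / (2 - p) ^ 2 * j))| ≤
      exp (964 / ((n : ℝ) + 3)) - 1 + 8 / (n + 3) := by
  obtain ⟨hα0, hα1⟩ := variance_ratio_bounds hp0 hp1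
  set α := p * (1 - p) / (2 - p) ^ 2
  have hN := cast_choose_two_eq n
  set N := (n + 3).choose 2
  have hn' : (6 : ℝ) ≤ n := by exact_mod_cast hn
  have hN1 : 1 ≤ N := by
    have : (1 : ℝ) ≤ N := by rw [hN]; nlinarith
    exact_mod_cast this
  have hKN : 2 * (2 * n + 3) ≤ N := by
    have : (2 * (2 * n + 3) : ℝ) ≤ N := by rw [hN]; nlinarith
    exact_mod_cast this
  have hmain := abs_avoidProb_div_sub_one_le hm hN1 hKN hp hk
  set q : ℝ := (k : ℝ) ^ 2 / (2 * N)
  have hq0 : 0 ≤ q := by positivity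
  have hx : 0 < (1 - p / 2) ^ k := pow_pos (by linarith) _
  have hrate : (k : ℝ) * (1 / N + 30 * ((2 * n + 3 : ℕ) / N : ℝ) ^ 2) ≤ 964 / (n + 3) := by
    have h1 : ((2 * n + 3 : ℕ) / N : ℝ) ≤ 4 / (n + 3) := by
      rw [hN, div_le_div_iff₀ (by positivity) (by positivity)]
      push_cast
      nlinarith
    have hk' : (k : ℝ) ≤ (2 * n + 3 : ℕ) := by exact_mod_cast hk
    calc (k : ℝ) * (1 / N + 30 * ((2 * n + 3 : ℕ) / N : ℝ) ^ 2)
        ≤ (2 * n + 3 : ℕ) * (1 / N + 30 * ((2 * n + 3 : ℕ) / N : ℝ) ^ 2) := by gcongr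
      _ = ((2 * n + 3 : ℕ) / N : ℝ) + 30 * (2 * n + 3 : ℕ) * ((2 * n + 3 : ℕ) / N : ℝ) ^ 2 := by
          ring
      _ ≤ 4 / (n + 3) + 30 * (2 * (n + 3)) * (4 / (n + 3)) ^ 2 := by
          gcongr
          push_cast
          linarith
      _ = 964 / (n + 3) := by field_simp; norm_num
  have hrate' := exp_le_exp.2 hrate
  have hsplit : avoidProb N m k / (1 - p / 2) ^ k - exp (-(α * j)) =
      (avoidProb N m k / ((1 - p / 2) ^ k * exp (-(α * q))) - 1) * exp (-(α * q)) +
        (exp (-(α * q)) - exp (-(α * j))) := by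
    field_simp
    ring
  have he : exp (-(α * q)) ≤ 1 := exp_le_one_iff.2 (by nlinarith)
  have hlip : |exp (-(α * q)) - exp (-(α * j))| ≤ 8 / (n + 3) := by
    refine (abs_exp_sub_exp_le (by nlinarith) (by nlinarith)).trans ?_
    rw [show -(α * q) - -(α * j) = -(α * (q - j)) by ring, abs_neg, abs_mul, abs_of_nonneg hα0]
    exact (mul_le_of_le_one_left (abs_nonneg _) hα1).trans hj
  rw [hsplit]
  refine (abs_add_le _ _).trans (add_le_add ?_ hlip)
  rw [abs_mul, abs_of_pos (exp_pos _)]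
  exact (mul_le_of_le_one_right (abs_nonneg _) he).trans (hmain.trans (by linarith))

lemma tendsto_div_nat_add_three (c : ℝ) :
    Tendsto (fun n : ℕ => c / ((n : ℝ) + 3)) atTop (nhds 0) :=
  tendsto_const_nhds.div_atTop (tendsto_atTop_add_const_right _ _ tendsto_natCast_atTop_atTop)

lemma tendsto_rate :
    Tendsto (fun n : ℕ => exp (964 / ((n : ℝ) + 3)) - 1 + 8 / (n + 3)) atTop (nhds 0) := by
  have h := ((continuous_exp.tendsto 0).comp (tendsto_div_nat_add_three 964)).sub_const 1
  simpa using h.add (tendsto_div_nat_add_three 8)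

lemma tendsto_nat_add_four_pow_mul_pow {r : ℝ} (hr0 : 0 < r) (hr1 : r < 1) (d : ℕ) :
    Tendsto (fun n : ℕ => ((n : ℝ) + 4) ^ d * r ^ n) atTop (nhds 0) := by
  have h := ((tendsto_pow_const_mul_const_pow_of_lt_one d hr0.le hr1).comp
    (tendsto_add_atTop_nat 4)).div_const (r ^ 4)
  rw [zero_div] at h
  refine h.congr fun n => ?_
  simp only [Function.comp, Nat.cast_add, Nat.cast_ofNat, pow_add]
  field_simp

lemma eventually_mul_pow_half_le_one {r : ℝ} (hr0 : 0 < r) (hr1 : r < 1) :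
    ∀ᶠ n : ℕ in atTop, ((n : ℝ) + 3) * r ^ ((n - 3) / 2) ≤ 1 := by
  have h := ((tendsto_nat_add_four_pow_mul_pow hr0 hr1 1).const_mul 2).comp
    (f := fun n : ℕ => (n - 3) / 2) (g := fun n : ℕ => 2 * (((n : ℝ) + 4) ^ 1 * r ^ n))
    (tendsto_atTop.2 fun b => eventually_atTop.2 ⟨2 * b + 3, fun n hn => by omega⟩)
  rw [mul_zero] at h
  filter_upwards [h.eventually_le_const one_pos] with n hn
  refine le_trans ?_ hn
  have h1 : ((n : ℝ) + 3) ≤ 2 * (((n - 3) / 2 : ℕ) + 4) := by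
    have : n + 3 ≤ 2 * ((n - 3) / 2 + 4) := by omega
    exact_mod_cast this
  have h2 : 0 ≤ r ^ ((n - 3) / 2) := by positivity
  simp only [Function.comp]
  nlinarith

variable {m : ℕ → ℕ} {p : ℕ → ℝ} {p₀ : ℝ}

lemma tendsto_not_reaches (hmN : ∀ n, m n ≤ (n + 3).choose 2)
    (hp : ∀ n, p n = m n / (n + 3).choose 2) (hp1 : ∀ n, p n ≤ 1) (hp₀ : 0 < p₀)
    (hpp₀ : ∀ᶠ n in atTop, p₀ ≤ p n) {s a : (n : ℕ) → Fin (n + 3)} (hsa : ∀ n, s n ≠ a n) :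
    Tendsto (fun n => PrGnm (n + 3) (m n) {f | ¬ Reaches f (s n) (a n)} / (1 - p n / 2) ^ (n + 2) -
      2 * exp (-(p n * (1 - p n) / (2 - p n) ^ 2))) atTop (nhds 0) := by
  obtain ⟨n₀, hn₀⟩ := hpp₀.exists
  have hp₀1 : p₀ ≤ 1 := hn₀.trans (hp1 _)
  have hr0 : 0 < 1 - p₀ / 2 := by linarith
  have hr1 : 1 - p₀ / 2 < 1 := by linarith
  have hlim := ((tendsto_nat_add_four_pow_mul_pow hr0 hr1 5).const_mul 2).add
    (tendsto_rate.const_mul 2)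
  rw [mul_zero, add_zero] at hlim
  refine squeeze_zero_norm' ?_ hlim
  filter_upwards [hpp₀, eventually_ge_atTop 6, eventually_mul_pow_half_le_one hr0 hr1]
    with n hpn hn hlarge
  have hN := cast_choose_two_eq n
  have hx0 : 0 < 1 - p n / 2 := by linarith [hp1 n]
  have hxr : 1 - p n / 2 ≤ 1 - p₀ / 2 := by linarith
  have herr := abs_PrGnm_not_reaches_sub_le (hsa n) (by omega) (hmN n) (hp₀.le.trans hpn) (hp1 n)
    (by rw [hp, mul_div_cancel₀]; rw [hN]; positivity) (by
      refine le_trans ?_ hlarge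
      push_cast
      gcongr ?_ * ?_
      exact (pow_le_pow_of_le_one hx0.le (by linarith) (by omega)).trans
        (pow_le_pow_left₀ hx0.le hxr _))
  have hmain := abs_avoidProb_div_pow_sub_le (j := 1) (k := n + 2) hn (hmN n) (hp n)
    (hp₀.le.trans hpn) (hp1 n) (by omega) one_pos.le (by
      rw [hN, show ((n + 2 : ℕ) : ℝ) ^ 2 / (2 * (((n : ℝ) + 3) * (n + 2) / 2)) - 1 =
        -(1 / (n + 3)) by push_cast; field_simp; ring, abs_neg, abs_of_pos (by positivity)]
      gcongr
      norm_num)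
  rw [mul_one] at hmain
  set x := 1 - p n / 2
  set P := PrGnm (n + 3) (m n) {f | ¬ Reaches f (s n) (a n)}
  set A := avoidProb ((n + 3).choose 2) (m n) (n + 2)
  set g := exp (-(p n * (1 - p n) / (2 - p n) ^ 2))
  rw [norm_eq_abs, show P / x ^ (n + 2) - 2 * g =
    (P - 2 * A) / x ^ (n + 2) + 2 * (A / x ^ (n + 2) - g) by ring]
  refine (abs_add_le _ _).trans (add_le_add ?_ (by rw [abs_mul, abs_two]; gcongr))
  rw [abs_div, abs_of_pos (pow_pos hx0 _), div_le_iff₀ (pow_pos hx0 _)]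
  refine herr.trans ?_
  have hxn : x ^ n ≤ (1 - p₀ / 2) ^ n := pow_le_pow_left₀ hx0.le hxr _
  have hC : (((n + 3).choose 2 : ℕ) : ℝ) + 1 ≤ (n + 4) ^ 2 := by rw [hN]; nlinarith
  have hx1 : x ≤ 1 := by linarith
  rw [show 2 * (n + 3) - 3 = n + (n + 2) + 1 by omega,
    show 2 * (n + 3 - 2) = n + (n + 2) by omega, pow_succ, pow_add x n (n + 2)]
  push_cast
  calc _ ≤ ((n : ℝ) + 4) ^ 2 * ((n + 4) ^ 3 * (x ^ n * x ^ (n + 2)) +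
        (n + 4) * ((n + 4) ^ 2 * (x ^ n * x ^ (n + 2)))) := by
        gcongr ?_ * (?_ + ?_ * (?_ ^ 2 * _))
        · rw [mul_comm]
          gcongr
          exact hx1.trans (one_le_pow₀ (by linarith [n.cast_nonneg (α := ℝ)]))
        · linarith
        · linarith
    _ = 2 * (((n : ℝ) + 4) ^ 5 * x ^ n) * x ^ (n + 2) := by ring
    _ ≤ _ := by gcongr

lemma tendsto_not_reaches_and (hmN : ∀ n, m n ≤ (n + 3).choose 2)
    (hp : ∀ n, p n = m n / (n + 3).choose 2) (hp1 : ∀ n, p n ≤ 1) (hp₀ : 0 < p₀)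
    (hpp₀ : ∀ᶠ n in atTop, p₀ ≤ p n) {s a b : (n : ℕ) → Fin (n + 3)} (hsa : ∀ n, s n ≠ a n)
    (hsb : ∀ n, s n ≠ b n) (hab : ∀ n, a n ≠ b n) :
    Tendsto (fun n => PrGnm (n + 3) (m n) {f | ¬ Reaches f (s n) (a n) ∧ ¬ Reaches f (b n) (s n)} /
      (1 - p n / 2) ^ (2 * n + 3) -
      3 * exp (-(p n * (1 - p n) / (2 - p n) ^ 2 * 4))) atTop (nhds 0) := by
  obtain ⟨n₀, hn₀⟩ := hpp₀.exists
  have hp₀1 : p₀ ≤ 1 := hn₀.trans (hp1 _)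
  have hr0 : 0 < 1 - p₀ ^ 2 / 4 := by nlinarith
  have hr1 : 1 - p₀ ^ 2 / 4 < 1 := by nlinarith
  have hlim := ((tendsto_nat_add_four_pow_mul_pow hr0 hr1 6).const_mul 288).add
    (tendsto_rate.const_mul 3)
  rw [mul_zero, mul_zero, add_zero] at hlim
  refine squeeze_zero_norm' ?_ hlim
  filter_upwards [hpp₀, eventually_ge_atTop 6, eventually_mul_pow_half_le_one hr0 hr1]
    with n hpn hn hlarge
  have hN := cast_choose_two_eq n
  have hx2 : 1 / 2 ≤ 1 - p n / 2 := by linarith [hp1 n]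
  have hx0 : 0 < 1 - p n / 2 := by linarith
  have hxr : 1 - p n / 2 ≤ 1 - p₀ ^ 2 / 4 := by nlinarith
  have hx1 : 1 - p n / 2 ≤ 1 := by linarith
  have herr := abs_PrGnm_not_reaches_and_sub_le (hsa n) (hsb n) (hab n) (by omega) (hmN n)
    (hp₀.le.trans hpn) (hp1 n)
    (by rw [hp, mul_div_cancel₀]; rw [hN]; positivity) (by
      refine le_trans ?_ hlarge
      push_cast
      gcongr ?_ * ?_
      exact pow_le_pow_left₀ hx0.le hxr _)
  have hmain := abs_avoidProb_div_pow_sub_le (j := 4) (k := 2 * n + 3) hn (hmN n) (hp n)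
    (hp₀.le.trans hpn) (hp1 n) le_rfl (by norm_num) (by
      rw [hN, show ((2 * n + 3 : ℕ) : ℝ) ^ 2 / (2 * (((n : ℝ) + 3) * (n + 2) / 2)) - 4 =
        -((8 * n + 15) / ((n + 3) * (n + 2))) by push_cast; field_simp; ring, abs_neg,
        abs_of_pos (by positivity), div_le_div_iff₀ (by positivity) (by positivity)]
      nlinarith)
  have hiso : (1 - p n) ^ n ≤ (1 - p₀ ^ 2 / 4) ^ n * (1 - p n / 2) ^ (2 * n) := by
    rw [pow_mul, ← mul_pow]
    refine pow_le_pow_left₀ (by linarith [hp1 n]) ?_ _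
    have : (p₀ * (1 - p n / 2)) ^ 2 ≤ p n ^ 2 :=
      pow_le_pow_left₀ (by positivity) ((mul_le_of_le_one_right hp₀.le hx1).trans hpn) 2
    nlinarith
  set x := 1 - p n / 2
  set r := 1 - p₀ ^ 2 / 4
  set P := PrGnm (n + 3) (m n) {f | ¬ Reaches f (s n) (a n) ∧ ¬ Reaches f (b n) (s n)}
  rw [show 2 * (n + 3) - 3 = 2 * n + 3 by omega] at herr
  set A := avoidProb ((n + 3).choose 2) (m n) (2 * n + 3)
  set g := exp (-(p n * (1 - p n) / (2 - p n) ^ 2 * 4))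
  rw [norm_eq_abs, show P / x ^ (2 * n + 3) - 3 * g =
    (P - 3 * A) / x ^ (2 * n + 3) + 3 * (A / x ^ (2 * n + 3) - g) by ring]
  refine (abs_add_le _ _).trans (add_le_add ?_ (by
    rw [abs_mul, abs_of_pos (three_pos : (0 : ℝ) < 3)]; gcongr))
  rw [abs_div, abs_of_pos (pow_pos hx0 _), div_le_iff₀ (pow_pos hx0 _)]
  refine herr.trans ?_
  have hxn : x ^ n ≤ r ^ n := pow_le_pow_left₀ hx0.le hxr _
  have hC : (((n + 3).choose 2 : ℕ) : ℝ) + 1 ≤ (n + 4) ^ 2 := by rw [hN]; nlinarith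
  have hx3 : 1 / 8 ≤ x ^ 3 := by
    have := pow_le_pow_left₀ (by norm_num) hx2 3
    norm_num at this ⊢
    exact this
  have hmid : x ^ (3 * n) ≤ r ^ n * x ^ (2 * n) := by
    rw [show 3 * n = n + 2 * n by ring, pow_add]
    gcongr
  have hlast : x ^ (3 * (n - 1)) ≤ 8 * (r ^ n * x ^ (2 * n)) := by
    have h : x ^ (3 * (n - 1)) * x ^ 3 = x ^ (3 * n) := by
      rw [← pow_add]
      congr 1
      omega
    have h0 : 0 ≤ x ^ (3 * (n - 1)) := by positivity
    nlinarith
  have h4 : (1 : ℝ) ≤ (n : ℝ) + 4 := by linarith [n.cast_nonneg (α := ℝ)]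
  rw [show n + 3 - 3 = n by omega, show n + 3 - 4 = n - 1 by omega]
  push_cast
  calc _ ≤ 2 * (((n : ℝ) + 4) ^ 2 * ((n + 4) * ((n + 4) ^ 3 * (r ^ n * x ^ (2 * n))) +
        (n + 4) ^ 4 * (r ^ n * x ^ (2 * n)) +
          2 * ((n + 4) ^ 4 * (8 * (r ^ n * x ^ (2 * n)))))) := by
        have h3 : ((n : ℝ) + 3) ^ 2 ≤ ((n : ℝ) + 4) ^ 4 := by
          calc ((n : ℝ) + 3) ^ 2 ≤ ((n : ℝ) + 4) ^ 2 := by gcongr; norm_num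
            _ ≤ ((n : ℝ) + 4) ^ 4 := pow_le_pow_right₀ h4 (by norm_num)
        have h5 : 0 ≤ 1 - p n := by linarith [hp1 n]
        gcongr ?_ * (?_ * (?_ * (?_ ^ 3 * ?_) + ?_ * ?_ + ?_ * (?_ * ?_)))
        · linarith
        · linarith
    _ = 288 * (((n : ℝ) + 4) ^ 6 * r ^ n) * x ^ (2 * n) * (1 / 8) := by ring
    _ ≤ 288 * (((n : ℝ) + 4) ^ 6 * r ^ n) * x ^ (2 * n) * x ^ 3 := by gcongr
    _ = _ := by ring

end Asymptotics

lemma Filter.Tendsto.zero_mul_of_abs_le {f h : ℕ → ℝ} {C : ℝ} (hf : Tendsto f atTop (nhds 0))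
    (hh : ∀ᶠ n in atTop, |h n| ≤ C) : Tendsto (fun n => f n * h n) atTop (nhds 0) :=
  hf.zero_mul_isBoundedUnder_le (isBoundedUnder_of_eventually_le hh)

lemma tendsto_ratio_sub {x g u u' v : ℕ → ℝ} {c d : ℝ} (hc : 0 < c) (hd : 0 < d)
    (hx0 : ∀ n, c ≤ x n) (hx1 : ∀ n, x n ≤ 1) (hg0 : ∀ n, d ≤ g n) (hg1 : ∀ n, g n ≤ 1)
    (hu : Tendsto (fun n => u n - 2 * g n) atTop (nhds 0))
    (hu' : Tendsto (fun n => u' n - 2 * g n) atTop (nhds 0))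
    (hv : Tendsto (fun n => v n - 3 * g n ^ 4) atTop (nhds 0)) :
    (∀ᶠ n in atTop, 0 < u n) ∧
    Tendsto (fun n => (v n - x n * (u n * u' n)) / (x n * u n ^ 2) -
      (3 / (4 * x n) * g n ^ 2 - 1)) atTop (nhds 0) ∧
    Tendsto (fun n => (v n - x n * (u n * u' n)) / g n ^ 2 -
      (3 * g n ^ 2 - 4 * x n)) atTop (nhds 0) := by
  have hxpos : ∀ n, 0 < x n := fun n => hc.trans_le (hx0 n)
  have hgpos : ∀ n, 0 < g n := fun n => hd.trans_le (hg0 n)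
  have hxb : ∀ᶠ n in atTop, |x n| ≤ 1 :=
    .of_forall fun n => by rw [abs_of_pos (hxpos n)]; exact hx1 n
  have hgb : ∀ᶠ n in atTop, |g n| ≤ 1 :=
    .of_forall fun n => by rw [abs_of_pos (hgpos n)]; exact hg1 n
  have hg2b : ∀ᶠ n in atTop, |g n ^ 2| ≤ 1 :=
    .of_forall fun n => by
      rw [abs_of_pos (pow_pos (hgpos n) 2)]; exact pow_le_one₀ (hgpos n).le (hg1 n)
  have hupos : ∀ᶠ n in atTop, d ≤ u n := by
    filter_upwards [hu.eventually_const_le (neg_lt_zero.2 hd)] with n hn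
    linarith [hg0 n]
  have hmul : ∀ {w : ℕ → ℝ}, Tendsto (fun n => w n - 2 * g n) atTop (nhds 0) →
      Tendsto (fun n => u n * w n - 4 * g n ^ 2) atTop (nhds 0) := fun {w} hw => by
    have h := ((hu.mul hw).add ((hw.zero_mul_of_abs_le hgb).const_mul 2)).add
      ((hu.zero_mul_of_abs_le hgb).const_mul 2)
    simp only [mul_zero, add_zero] at h
    exact h.congr fun n => by ring
  refine ⟨hupos.mono fun n hn => hd.trans_le hn, ?_, ?_⟩
  · have hdiff := (hmul hu').sub (hmul hu)
    rw [sub_zero] at hdiff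
    have hnum := (hv.sub (hdiff.zero_mul_of_abs_le hxb)).sub
      (((hmul hu).zero_mul_of_abs_le hg2b).const_mul (3 / 4))
    simp only [mul_zero, sub_zero] at hnum
    have hden : ∀ᶠ n in atTop, |(x n * u n ^ 2)⁻¹| ≤ (c * d ^ 2)⁻¹ := by
      filter_upwards [hupos] with n hn
      have := hxpos n
      have := hx0 n
      have : 0 < u n := hd.trans_le hn
      rw [abs_of_pos (by positivity)]
      gcongr
    refine (hnum.zero_mul_of_abs_le hden).congr' ?_
    filter_upwards [hupos] with n hn
    have := hxpos n
    have : 0 < u n := hd.trans_le hn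
    field_simp
    ring
  · have hnum := hv.sub ((hmul hu').zero_mul_of_abs_le hxb)
    rw [sub_zero] at hnum
    have hden : ∀ᶠ n in atTop, |(g n ^ 2)⁻¹| ≤ (d ^ 2)⁻¹ := .of_forall fun n => by
      have := hgpos n
      have := hg0 n
      rw [abs_of_pos (by positivity)]
      gcongr
    refine (hnum.zero_mul_of_abs_le hden).congr fun n => ?_
    have := hgpos n
    field_simp
    ring

/-- Suppose `m = m(n) → ∞`, let `p(n) := m(n)/C(n,2)` and assume
`liminf p(n) > 0`. For distinct vertices `s, a, b` of `⃗G(n,m)` (graphs on `n + 3`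
vertices), `Cov({s ↛ a}, {b ↛ s})` equals
`(3/(4-2p) · exp(-2p(1-p)/(2-p)²) - 1 + o(1)) · P(s ↛ a)²` and also equals
`(3 exp(-2p(1-p)/(2-p)²) - 4 + 2p + o(1)) · (1-p/2)^(2n-3) · exp(-2p(1-p)/(2-p)²)`. -/
theorem gnm_covariance_asymptotics
    (m : ℕ → ℕ) (hmN : ∀ n, m n ≤ Nat.choose (n + 3) 2)
    (hm : Filter.Tendsto m Filter.atTop Filter.atTop)
    (hliminf : 0 < Filter.liminf
      (fun n : ℕ => (m n : ℝ) / (Nat.choose (n + 3) 2 : ℝ)) Filter.atTop)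
    (s a b : (n : ℕ) → Fin (n + 3))
    (hsa : ∀ n, s n ≠ a n) (hsb : ∀ n, s n ≠ b n) (hab : ∀ n, a n ≠ b n) :
    ∃ ε₁ ε₂ : ℕ → ℝ,
      Filter.Tendsto ε₁ Filter.atTop (nhds 0) ∧
      Filter.Tendsto ε₂ Filter.atTop (nhds 0) ∧
      ∀ n : ℕ,
        (PrGnm (n + 3) (m n) {f | ¬ Reaches f (s n) (a n) ∧ ¬ Reaches f (b n) (s n)} -
            PrGnm (n + 3) (m n) {f | ¬ Reaches f (s n) (a n)} *
              PrGnm (n + 3) (m n) {f | ¬ Reaches f (b n) (s n)} =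
          (3 / (4 - 2 * ((m n : ℝ) / (Nat.choose (n + 3) 2 : ℝ))) *
              Real.exp (-(2 * ((m n : ℝ) / (Nat.choose (n + 3) 2 : ℝ)) *
                  (1 - (m n : ℝ) / (Nat.choose (n + 3) 2 : ℝ))) /
                (2 - (m n : ℝ) / (Nat.choose (n + 3) 2 : ℝ)) ^ 2) - 1 + ε₁ n) *
            (PrGnm (n + 3) (m n) {f | ¬ Reaches f (s n) (a n)}) ^ 2) ∧
        (PrGnm (n + 3) (m n) {f | ¬ Reaches f (s n) (a n) ∧ ¬ Reaches f (b n) (s n)} -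
            PrGnm (n + 3) (m n) {f | ¬ Reaches f (s n) (a n)} *
              PrGnm (n + 3) (m n) {f | ¬ Reaches f (b n) (s n)} =
          (3 * Real.exp (-(2 * ((m n : ℝ) / (Nat.choose (n + 3) 2 : ℝ)) *
                  (1 - (m n : ℝ) / (Nat.choose (n + 3) 2 : ℝ))) /
                (2 - (m n : ℝ) / (Nat.choose (n + 3) 2 : ℝ)) ^ 2) - 4 +
              2 * ((m n : ℝ) / (Nat.choose (n + 3) 2 : ℝ)) + ε₂ n) *
            (1 - ((m n : ℝ) / (Nat.choose (n + 3) 2 : ℝ)) / 2) ^ (2 * (n + 3) - 3) *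
            Real.exp (-(2 * ((m n : ℝ) / (Nat.choose (n + 3) 2 : ℝ)) *
                (1 - (m n : ℝ) / (Nat.choose (n + 3) 2 : ℝ))) /
              (2 - (m n : ℝ) / (Nat.choose (n + 3) 2 : ℝ)) ^ 2)) := by
  have hN : ∀ n : ℕ, (0 : ℝ) < ((n + 3).choose 2 : ℕ) := fun n => by
    exact_mod_cast Nat.choose_pos (by omega)
  have hp0 : ∀ n, 0 ≤ (m n : ℝ) / (Nat.choose (n + 3) 2 : ℝ) := fun n => by positivity
  have hp1 : ∀ n, (m n : ℝ) / (Nat.choose (n + 3) 2 : ℝ) ≤ 1 := fun n =>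
    (div_le_one (hN n)).2 (by exact_mod_cast hmN n)
  obtain ⟨p, hp⟩ : ∃ p : ℕ → ℝ, ∀ n, p n = (m n : ℝ) / (Nat.choose (n + 3) 2 : ℝ) :=
    ⟨_, fun _ => rfl⟩
  simp only [← hp] at hliminf hp0 hp1 ⊢
  obtain ⟨p₀, hp₀, hp₀'⟩ := exists_between hliminf
  have hpp₀ : ∀ᶠ n in atTop, p₀ ≤ p n :=
    (eventually_lt_of_lt_liminf hp₀' (isBoundedUnder_of_eventually_ge (.of_forall hp0))).mono
      fun n hn => hn.le
  have hu := tendsto_not_reaches hmN hp hp1 hp₀ hpp₀ hsa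
  have hu' := tendsto_not_reaches hmN hp hp1 hp₀ hpp₀ fun n => (hsb n).symm
  have hv := tendsto_not_reaches_and hmN hp hp1 hp₀ hpp₀ hsa hsb hab
  have hxpos : ∀ n, 0 < 1 - p n / 2 := fun n => by linarith [hp1 n]
  have hg4 : ∀ y : ℝ, exp (-(y * 4)) = exp (-y) ^ 4 := fun y => by
    rw [← exp_nat_mul]
    ring_nf
  have hg2 : ∀ n, exp (-(2 * p n * (1 - p n)) / (2 - p n) ^ 2) =
      exp (-(p n * (1 - p n) / (2 - p n) ^ 2)) ^ 2 := fun n => by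
    rw [← exp_nat_mul]
    congr 1
    push_cast
    ring
  simp only [hg4] at hv
  obtain ⟨hupos, h₁, h₂⟩ := tendsto_ratio_sub (x := fun n => 1 - p n / 2) (c := 1 / 2)
    (d := exp (-1)) (by norm_num) (exp_pos _) (fun n => by linarith [hp1 n])
    (fun n => by linarith [hp0 n])
    (fun n => exp_le_exp.2 (neg_le_neg (variance_ratio_bounds (hp0 n) (hp1 n)).2))
    (fun n => exp_le_one_iff.2 (neg_nonpos.2 (variance_ratio_bounds (hp0 n) (hp1 n)).1)) hu hu' hv
  simp only [hg2]
  have hle : ∀ n, PrGnm (n + 3) (m n) {f | ¬ Reaches f (s n) (a n) ∧ ¬ Reaches f (b n) (s n)} ≤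
      PrGnm (n + 3) (m n) {f | ¬ Reaches f (s n) (a n)} := fun n =>
    prWeight_mono (PrGnm_weight_nonneg _ _) fun f hf => hf.1
  have hnonneg : ∀ n,
      0 ≤ PrGnm (n + 3) (m n) {f | ¬ Reaches f (s n) (a n) ∧ ¬ Reaches f (b n) (s n)} := fun n =>
    prWeight_nonneg (PrGnm_weight_nonneg _ _) _
  obtain ⟨P, hP⟩ : ∃ P : ℕ → ℝ, ∀ n, P n =
    PrGnm (n + 3) (m n) {f | ¬ Reaches f (s n) (a n) ∧ ¬ Reaches f (b n) (s n)} := ⟨_, fun _ => rfl⟩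
  obtain ⟨Q, hQ⟩ : ∃ Q : ℕ → ℝ, ∀ n, Q n = PrGnm (n + 3) (m n) {f | ¬ Reaches f (s n) (a n)} :=
    ⟨_, fun _ => rfl⟩
  obtain ⟨R, hR⟩ : ∃ R : ℕ → ℝ, ∀ n, R n = PrGnm (n + 3) (m n) {f | ¬ Reaches f (b n) (s n)} :=
    ⟨_, fun _ => rfl⟩
  obtain ⟨g, hg⟩ : ∃ g : ℕ → ℝ, ∀ n, g n = exp (-(p n * (1 - p n) / (2 - p n) ^ 2)) :=
    ⟨_, fun _ => rfl⟩
  have hgpos : ∀ n, 0 < g n := fun n => hg n ▸ exp_pos _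
  simp only [← hP, ← hQ, ← hR, ← hg] at hupos h₁ h₂ hle hnonneg ⊢
  have hpow : ∀ n, (1 - p n / 2) ^ (2 * n + 3) * (1 - p n / 2) = ((1 - p n / 2) ^ (n + 2)) ^ 2 :=
    fun n => by ring
  have hratio : ∀ n, P n / (1 - p n / 2) ^ (2 * n + 3) - (1 - p n / 2) *
      (Q n / (1 - p n / 2) ^ (n + 2) * (R n / (1 - p n / 2) ^ (n + 2))) =
        (P n - Q n * R n) / (1 - p n / 2) ^ (2 * n + 3) := fun n => by
    have h1 := pow_pos (hxpos n) (2 * n + 3)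
    have h2 := pow_pos (hxpos n) (n + 2)
    have h3 := hpow n
    generalize (1 - p n / 2) ^ (n + 2) = X, (1 - p n / 2) ^ (2 * n + 3) = Y,
      1 - p n / 2 = x at h1 h2 h3
    field_simp
    linear_combination (Q n * R n) * h3
  simp only [hratio] at h₁ h₂
  refine ⟨fun n => if Q n = 0 then 0 else
      (P n - Q n * R n) / Q n ^ 2 - (3 / (4 - 2 * p n) * g n ^ 2 - 1),
    fun n => (P n - Q n * R n) / (1 - p n / 2) ^ (2 * n + 3) / g n ^ 2 -
      (3 * g n ^ 2 - 4 + 2 * p n), h₁.congr' ?_, h₂.congr fun n => by ring, fun n => ⟨?_, ?_⟩⟩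
  · filter_upwards [hupos] with n hn
    have hQn : Q n ≠ 0 := fun h => by simp [h] at hn
    rw [if_neg hQn, show 4 * (1 - p n / 2) = 4 - 2 * p n by ring, div_pow, ← hpow]
    have h1 := pow_pos (hxpos n) (2 * n + 3)
    have h2 := hxpos n
    generalize (1 - p n / 2) ^ (2 * n + 3) = Y, 1 - p n / 2 = x at h1 h2
    field_simp
  · by_cases hQn : Q n = 0
    · have hPn : P n = 0 := le_antisymm ((hle n).trans_eq hQn) (hnonneg n)
      simp [hQn, hPn]
    · beta_reduce
      rw [if_neg hQn, add_sub_cancel, div_mul_cancel₀ _ (pow_ne_zero 2 hQn)]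
  · have h1 := pow_pos (hxpos n) (2 * n + 3)
    have h2 := hgpos n
    rw [show 2 * (n + 3) - 3 = 2 * n + 3 by omega, add_sub_cancel, mul_right_comm,
      div_mul_cancel₀ _ (pow_ne_zero 2 h2.ne'), div_mul_cancel₀ _ h1.ne']
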